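/- arXiv:1111.6766 — 5 statements merged into one kernel-verified Lean document; each statement's English description precedes it below -/
import Mathlib

section
/- For each fixed k ≥ 0, the proportion of unlabelled n-element interval orders having exactly k unordered pairs {x, y} of distinct elements with duplicated holdings tends, as n → ∞, to e^{-π²/6} · (π²/6)^k / k!. That is, the number of pairs of elements with duplicated holdings in a uniformly random unlabelled n-element interval order converges in distribution to a Poisson random variable with mean π²/6. -/
open scoped Classical

/-- An interval order on `Fin n`: a strict partial order with no induced `2+2`. -/
def IntervalOrderRel (n : ℕ) : Type :=
  {r : Fin n → Fin n → Prop // IsStrictOrder (Fin n) r ∧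
    ∀ a b c d, r a b → r c d → r a d ∨ r c b}

/-- Two interval orders on `Fin n` are isomorphic if some permutation of the
ground set transforms one into the other. -/
def IntervalOrderIso {n : ℕ} (P Q : IntervalOrderRel n) : Prop :=
  ∃ e : Equiv.Perm (Fin n), ∀ a b, P.1 a b ↔ Q.1 (e a) (e b)

/-- `i n`: the number of unlabelled interval orders on `n` points, i.e. the number
of isomorphism classes of interval orders on an `n`-element set. -/
noncomputable def intervalOrderCount (n : ℕ) : ℕ :=
  Nat.card (Quot (IntervalOrderIso (n := n)))

/-- A poset is rigid if its only (order) automorphism is the identity. -/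
def IsRigid {n : ℕ} (P : IntervalOrderRel n) : Prop :=
  ∀ e : Equiv.Perm (Fin n), (∀ a b, P.1 a b ↔ P.1 (e a) (e b)) → e = 1

/-- `r n`: the number of unlabelled rigid interval orders on `n` points. -/
noncomputable def rigidIntervalOrderCount (n : ℕ) : ℕ :=
  Nat.card (Quot fun (P Q : {P : IntervalOrderRel n // IsRigid P}) =>
    IntervalOrderIso P.1 Q.1)

/-- `ℓ n`: the number of labelled interval orders on an `n`-element set. -/
noncomputable def labelledIntervalOrderCount (n : ℕ) : ℕ :=
  Nat.card (IntervalOrderRel n)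

/-- `x` and `y` are distinct elements with duplicated holdings:
`D(x) = D(y)` and `U(x) = U(y)`. -/
def DupHoldings {n : ℕ} (P : IntervalOrderRel n) (x y : Fin n) : Prop :=
  x ≠ y ∧ (∀ z, P.1 z x ↔ P.1 z y) ∧ (∀ z, P.1 x z ↔ P.1 y z)

/-- The number of unordered pairs `{x, y}` of distinct elements with duplicated
holdings. -/
noncomputable def dupPairCount {n : ℕ} (P : IntervalOrderRel n) : ℕ :=
  Nat.card {s : Finset (Fin n) // ∃ x y, DupHoldings P x y ∧ s = {x, y}}

/-- `P` has three distinct elements pairwise having duplicated holdings. -/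
def HasDupTriple {n : ℕ} (P : IntervalOrderRel n) : Prop :=
  ∃ x y z : Fin n, x ≠ y ∧ x ≠ z ∧ y ≠ z ∧
    DupHoldings P x y ∧ DupHoldings P x z ∧ DupHoldings P y z

/-- The Stirling number of the second kind `S(n, k)`: the number of partitions
of an `n`-element set into `k` non-empty parts. -/
noncomputable def stirling2 (n k : ℕ) : ℕ :=
  Nat.card {P : Finpartition (Finset.univ : Finset (Fin n)) // P.parts.card = k}

section PoissonLimit

open Filter Topology

section RatioLimits

variable {r : ℕ → ℝ} {μ : ℝ}

lemma tendsto_sub_mul_descFactorial_div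
    (h : Tendsto (fun n : ℕ => ((n : ℝ) + 1) * r n / r (n + 1)) atTop (𝓝 μ))
    (hr : ∀ n, 0 < r n) (j : ℕ) :
    Tendsto (fun n : ℕ => r (n - j) * (n.descFactorial j : ℝ) / r n) atTop (𝓝 (μ ^ j)) := by
  induction j with
  | zero =>
    simp only [Nat.sub_zero, Nat.descFactorial_zero, Nat.cast_one, mul_one, pow_zero]
    exact tendsto_const_nhds.congr fun n => (div_self (hr n).ne').symm
  | succ j ih =>
    have h2 := ih.mul (h.comp (tendsto_sub_atTop_nat (j + 1)))
    rw [← pow_succ] at h2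
    refine h2.congr' ?_
    filter_upwards [eventually_ge_atTop (j + 1)] with n hn
    have e1 : n - (j + 1) + 1 = n - j := by omega
    have e2 : ((n - (j + 1) : ℕ) : ℝ) + 1 = ((n - j : ℕ) : ℝ) := by
      rw [← e1]; push_cast; ring
    simp only [Function.comp, e1, e2, Nat.descFactorial_succ, Nat.cast_mul]
    have := hr n
    have := hr (n - j)
    field_simp

lemma sub_mul_descFactorial_div_le {C : ℝ} (hC : ∀ n : ℕ, ((n : ℝ) + 1) * r n / r (n + 1) ≤ C)
    (hr : ∀ n, 0 < r n) (n j : ℕ) :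
    r (n - j) * (n.descFactorial j : ℝ) / r n ≤ C ^ j := by
  have hC0 : 0 ≤ C := le_trans (by have := hr 0; have := hr 1; positivity) (hC 0)
  induction j with
  | zero => simp [(hr n).ne']
  | succ j ih =>
    rcases le_or_gt n j with hj | hj
    · rw [Nat.descFactorial_of_lt (by omega)]
      simp only [Nat.cast_zero, mul_zero, zero_div]
      positivity
    · have e1 : n - (j + 1) + 1 = n - j := by omega
      have e2 : ((n - (j + 1) : ℕ) : ℝ) + 1 = ((n - j : ℕ) : ℝ) := by
        rw [← e1]; push_cast; ring
      have h1 := hC (n - (j + 1))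
      rw [e1, e2] at h1
      have p1 := hr n
      have p2 := hr (n - j)
      have p3 := hr (n - (j + 1))
      calc _ = r (n - j) * (n.descFactorial j : ℝ) / r n *
            (((n - j : ℕ) : ℝ) * r (n - (j + 1)) / r (n - j)) := by
              rw [Nat.descFactorial_succ, Nat.cast_mul]; field_simp
        _ ≤ C ^ j * C := mul_le_mul ih h1 (by positivity) (by positivity)
        _ = _ := (pow_succ _ _).symm

lemma tendsto_sum_sub_mul_div
    (h : Tendsto (fun n : ℕ => ((n : ℝ) + 1) * r n / r (n + 1)) atTop (𝓝 μ))
    (hr : ∀ n, 0 < r n) {c : ℕ → ℕ → ℝ} {a : ℝ}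
    (hc : ∀ n j, |c n j| * j.factorial ≤ n.descFactorial j)
    (hlim : ∀ j, Tendsto (fun n : ℕ => c n j / (n.descFactorial j : ℝ)) atTop
      (𝓝 (a ^ j / (j.factorial : ℝ)))) :
    Tendsto (fun n : ℕ => (∑ j ∈ Finset.range (n + 1), r (n - j) * c n j) / r n) atTop
      (𝓝 (Real.exp (a * μ))) := by
  obtain ⟨C, hC⟩ := h.bddAbove_range
  have hC' : ∀ n : ℕ, ((n : ℝ) + 1) * r n / r (n + 1) ≤ C := fun n => hC ⟨n, rfl⟩
  have hterm : ∀ j, Tendsto (fun n : ℕ => r (n - j) * c n j / r n) atTop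
      (𝓝 ((a * μ) ^ j / j.factorial)) := by
    intro j
    have := (tendsto_sub_mul_descFactorial_div h hr j).mul (hlim j)
    rw [← mul_div_assoc, ← mul_pow, mul_comm μ] at this
    refine this.congr' ?_
    filter_upwards [eventually_ge_atTop j] with n hn
    have p1 : (n.descFactorial j : ℝ) ≠ 0 := by
      exact_mod_cast (Nat.descFactorial_pos.2 hn).ne'
    have := hr n
    field_simp
  have hT := tendsto_tsum_of_dominated_convergence
    (f := fun (n : ℕ) (j : ℕ) => r (n - j) * c n j / r n)
    (g := fun j : ℕ => (a * μ) ^ j / (j.factorial : ℝ)) (𝓕 := atTop)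
    (bound := fun j : ℕ => C ^ j / (j.factorial : ℝ))
    (Real.summable_pow_div_factorial C) hterm (Eventually.of_forall fun n j => by
      have p1 := hr n
      have p2 := hr (n - j)
      rw [norm_div, norm_mul, Real.norm_of_nonneg p1.le, Real.norm_of_nonneg p2.le,
        Real.norm_eq_abs]
      refine le_trans ?_ (div_le_div_of_nonneg_right
        (sub_mul_descFactorial_div_le hC' hr n j) (by positivity))
      rw [le_div_iff₀ (by positivity), div_mul_eq_mul_div, mul_assoc]
      have := hc n j
      gcongr)
  have hexp : ∑' j : ℕ, (a * μ) ^ j / (j.factorial : ℝ) = Real.exp (a * μ) := by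
    rw [Real.exp_eq_exp_ℝ, NormedSpace.exp_eq_tsum_div]
  rw [hexp] at hT
  refine hT.congr fun n => ?_
  rw [Finset.sum_div, tsum_eq_sum]
  intro j hj
  have : n < j := by simpa [Nat.lt_succ_iff] using hj
  have := hc n j
  rw [Nat.descFactorial_of_lt (by assumption)] at this
  have h0 : c n j = 0 := by
    have hf : (0 : ℝ) < j.factorial := by positivity
    rw [Nat.cast_zero] at this
    exact abs_eq_zero.1 (le_antisymm (by_contra fun hlt => by
      have := mul_pos (not_le.1 hlt) hf; linarith) (abs_nonneg _))
  simp [h0]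

end RatioLimits

lemma choose_pred_mul_factorial_le (n j : ℕ) :
    (n - 1).choose j * j.factorial ≤ n.descFactorial j := by
  rw [mul_comm, ← Nat.descFactorial_eq_factorial_mul_choose]
  exact Nat.descFactorial_le _ (Nat.sub_le _ _)

lemma choose_sub_mul_factorial_le (n j : ℕ) :
    (n - j).choose j * j.factorial ≤ n.descFactorial j := by
  rw [mul_comm, ← Nat.descFactorial_eq_factorial_mul_choose]
  exact Nat.descFactorial_le _ (Nat.sub_le _ _)

lemma tendsto_choose_sub_div_descFactorial (i j : ℕ) :
    Tendsto (fun n : ℕ => ((n - i).choose j : ℝ) / (n.descFactorial j : ℝ)) atTop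
      (𝓝 (1 / (j.factorial : ℝ))) := by
  have h1 : Asymptotics.IsEquivalent atTop (fun n : ℕ => ((n - i).choose j : ℝ))
      (fun n : ℕ => (n : ℝ) ^ j / j.factorial) := by
    refine ((isEquivalent_choose j).comp_tendsto (tendsto_sub_atTop_nat i)).trans ?_
    refine Asymptotics.IsEquivalent.div (Asymptotics.IsEquivalent.pow ?_ j)
      Asymptotics.IsEquivalent.refl
    have h0 : Asymptotics.IsEquivalent atTop (fun n : ℕ => (n : ℝ) - i) (fun n : ℕ => (n : ℝ)) := by
      refine Asymptotics.IsEquivalent.sub_isLittleO Asymptotics.IsEquivalent.refl ?_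
      exact Asymptotics.isLittleO_const_left.2 (Or.inr
        (tendsto_norm_atTop_atTop.comp tendsto_natCast_atTop_atTop))
    refine h0.congr_left ?_
    filter_upwards [eventually_ge_atTop i] with n hn
    simp [Nat.cast_sub hn]
  have h2 : Asymptotics.IsEquivalent atTop (fun n : ℕ => (n.descFactorial j : ℝ))
      (fun n : ℕ => (n : ℝ) ^ j) := isEquivalent_descFactorial j
  have h3 := h1.div h2
  refine h3.symm.tendsto_nhds ?_
  refine tendsto_const_nhds.congr' ?_
  filter_upwards [eventually_gt_atTop 0] with n hn
  have : (n : ℝ) ≠ 0 := by positivity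
  simp only [Pi.div_apply]
  field_simp

lemma tendsto_div_exp_neg_mul_pow_of_ratio {r I : ℕ → ℕ} {N : ℕ → ℕ → ℕ} {μ : ℝ}
    (h : Tendsto (fun n : ℕ => ((n : ℝ) + 1) * r n / r (n + 1)) atTop (𝓝 μ))
    (hr : ∀ n, 0 < r n)
    (hI : ∀ n, I n = ∑ j ∈ Finset.range (n + 1), r (n - j) * (n - 1).choose j)
    (hlow : ∀ n k, k ≤ n → r (n - k) * (n - k).choose k ≤ N n k)
    (hup : ∀ n, ∑ k ∈ Finset.range (n + 1), N n k ≤ I n) (k : ℕ) :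
    Tendsto (fun n : ℕ => (N n k : ℝ) / (I n : ℝ)) atTop
      (𝓝 (Real.exp (-μ) * μ ^ k / k.factorial)) := by
  have hr' : ∀ n, (0 : ℝ) < r n := fun n => by exact_mod_cast hr n
  have hA := tendsto_sum_sub_mul_div (r := fun n => (r n : ℝ)) h hr'
    (a := 1) (c := fun n j => ((n - 1).choose j : ℝ))
    (fun n j => by rw [Nat.abs_cast]; exact_mod_cast choose_pred_mul_factorial_le n j)
    (fun j => by simpa using tendsto_choose_sub_div_descFactorial 1 j)
  have hB := tendsto_sum_sub_mul_div (r := fun n => (r n : ℝ)) h hr'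
    (a := 1) (c := fun n j => ((n - j).choose j : ℝ))
    (fun n j => by rw [Nat.abs_cast]; exact_mod_cast choose_sub_mul_factorial_le n j)
    (fun j => by simpa using tendsto_choose_sub_div_descFactorial j j)
  rw [one_mul] at hA hB
  have hterm : Tendsto (fun n : ℕ => (r (n - k) : ℝ) * ((n - k).choose k : ℝ) / r n) atTop
      (𝓝 (μ ^ k / k.factorial)) := by
    have := (tendsto_sub_mul_descFactorial_div (r := fun n => (r n : ℝ)) h hr' k).mul
      (tendsto_choose_sub_div_descFactorial k k)
    rw [mul_one_div] at this
    refine this.congr' ?_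
    filter_upwards [eventually_ge_atTop k] with n hn
    have p1 : (n.descFactorial k : ℝ) ≠ 0 := by
      exact_mod_cast (Nat.descFactorial_pos.2 hn).ne'
    have := hr' n
    field_simp
  have hIr : Tendsto (fun n : ℕ => (I n : ℝ) / r n) atTop (𝓝 (Real.exp μ)) := by
    refine hA.congr fun n => ?_
    rw [hI]; push_cast; rfl
  have hN : Tendsto (fun n : ℕ => (N n k : ℝ) / r n) atTop (𝓝 (μ ^ k / k.factorial)) := by
    have hU := (hIr.sub hB).add hterm
    rw [sub_self, zero_add] at hU
    refine tendsto_of_tendsto_of_tendsto_of_le_of_le' hterm hU ?_ ?_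
    · filter_upwards [eventually_ge_atTop k] with n hn
      have := hr' n
      gcongr
      exact_mod_cast hlow n k hn
    · filter_upwards [eventually_ge_atTop k] with n hn
      have hk : k ∈ Finset.range (n + 1) := Finset.mem_range.2 (by omega)
      have h1 := Finset.add_sum_erase _ (fun j => N n j) hk
      have h2 := Finset.add_sum_erase _ (fun j => r (n - j) * (n - j).choose j) hk
      have h3 : ∑ j ∈ (Finset.range (n + 1)).erase k, r (n - j) * (n - j).choose j ≤
          ∑ j ∈ (Finset.range (n + 1)).erase k, N n j :=
        Finset.sum_le_sum fun j hj => hlow n j (by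
          have := Finset.mem_of_mem_erase hj
          rw [Finset.mem_range] at this; omega)
      have h4 := hup n
      have h5 : N n k + ∑ j ∈ Finset.range (n + 1), r (n - j) * (n - j).choose j ≤
          I n + r (n - k) * (n - k).choose k := by
        omega
      have h6 : (N n k : ℝ) + ∑ j ∈ Finset.range (n + 1), (r (n - j) : ℝ) * ((n - j).choose j : ℝ) ≤
          I n + (r (n - k) : ℝ) * ((n - k).choose k : ℝ) := by exact_mod_cast h5
      have := hr' n
      rw [← sub_div, ← add_div]
      gcongr
      linarith
  have := hN.div hIr (Real.exp_pos μ).ne'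
  have e : μ ^ k / k.factorial / Real.exp μ = Real.exp (-μ) * μ ^ k / k.factorial := by
    rw [Real.exp_neg]; field_simp
  rw [e] at this
  refine this.congr fun n => ?_
  have := hr' n
  simp only [Pi.div_apply]
  field_simp

/-- The elementary symmetric polynomial of degree `j` in `0 - b, 1 - b, …, (m - 1) - b`. -/
noncomputable def shiftedEsymm (b : ℝ) : ℕ → ℕ → ℝ
  | _, 0 => 1
  | 0, _ + 1 => 0
  | m + 1, j + 1 => shiftedEsymm b m (j + 1) + (m - b) * shiftedEsymm b m j

lemma shiftedEsymm_zero_right (b : ℝ) (m : ℕ) : shiftedEsymm b m 0 = 1 := by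
  cases m <;> rfl

lemma shiftedEsymm_succ_eq_sum (b : ℝ) (m j : ℕ) :
    shiftedEsymm b m (j + 1) = ∑ i ∈ Finset.range m, ((i : ℝ) - b) * shiftedEsymm b i j := by
  induction m with
  | zero => rfl
  | succ m ih => rw [Finset.sum_range_succ, ← ih]; rfl

lemma shiftedEsymm_eq_zero_of_lt (b : ℝ) {m j : ℕ} (h : m < j) : shiftedEsymm b m j = 0 := by
  induction m generalizing j with
  | zero => obtain ⟨j, rfl⟩ := Nat.exists_eq_succ_of_ne_zero h.ne'; rfl
  | succ m ih =>
    obtain ⟨j, rfl⟩ := Nat.exists_eq_succ_of_ne_zero (Nat.ne_zero_of_lt h)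
    change shiftedEsymm b m (j + 1) + (m - b) * shiftedEsymm b m j = 0
    rw [ih (by omega), ih (by omega)]; ring

lemma prod_range_sub_eq_sum_shiftedEsymm {A : Type*} [CommRing A] [Algebra ℝ A] (b : ℝ) (y : A)
    (m : ℕ) :
    ∏ i ∈ Finset.range m, (y - algebraMap ℝ A (i - b)) =
      ∑ j ∈ Finset.range (m + 1), algebraMap ℝ A ((-1) ^ j * shiftedEsymm b m j) * y ^ (m - j) := by
  induction m with
  | zero => simp [shiftedEsymm_zero_right]
  | succ m ih =>
    rw [Finset.prod_range_succ, ih, Finset.sum_range_succ' _ (m + 1), Finset.sum_mul]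
    have h1 : ∀ j ∈ Finset.range (m + 1),
        algebraMap ℝ A ((-1) ^ j * shiftedEsymm b m j) * y ^ (m - j) *
          (y - algebraMap ℝ A (m - b)) =
        algebraMap ℝ A ((-1) ^ j * shiftedEsymm b m j) * y ^ (m + 1 - j) +
        algebraMap ℝ A ((-1) ^ (j + 1) * ((m - b) * shiftedEsymm b m j)) * y ^ (m - j) := by
      intro j hj
      rw [Nat.succ_sub (by simpa [Nat.lt_succ_iff] using hj), pow_succ y]
      simp only [map_mul, map_pow, map_neg, map_one]
      ring
    rw [Finset.sum_congr rfl h1, Finset.sum_add_distrib]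
    have h2 : ∑ j ∈ Finset.range (m + 1),
        algebraMap ℝ A ((-1) ^ j * shiftedEsymm b m j) * y ^ (m + 1 - j) =
        ∑ j ∈ Finset.range (m + 1),
        algebraMap ℝ A ((-1) ^ (j + 1) * shiftedEsymm b m (j + 1)) * y ^ (m - j) + y ^ (m + 1) := by
      rw [Finset.sum_range_succ', Finset.sum_range_succ,
        shiftedEsymm_eq_zero_of_lt b (Nat.lt_succ_self m)]
      simp [shiftedEsymm_zero_right]
    rw [h2]
    have h3 : ∀ j ∈ Finset.range (m + 1),
        algebraMap ℝ A ((-1) ^ (j + 1) * shiftedEsymm b (m + 1) (j + 1)) *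
          y ^ (m + 1 - (j + 1)) =
        algebraMap ℝ A ((-1) ^ (j + 1) * shiftedEsymm b m (j + 1)) * y ^ (m - j) +
        algebraMap ℝ A ((-1) ^ (j + 1) * ((m - b) * shiftedEsymm b m j)) * y ^ (m - j) := by
      intro j _
      rw [← add_mul, ← map_add, ← mul_add, Nat.succ_sub_succ]; rfl
    rw [Finset.sum_congr rfl h3, Finset.sum_add_distrib]
    simp only [shiftedEsymm_zero_right]
    simp
    ring

lemma abs_shiftedEsymm_le {b : ℝ} (h0 : 0 ≤ b) (h1 : b ≤ 1) (m j : ℕ) :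
    |shiftedEsymm b m j| * j.factorial ≤ (m.descFactorial j : ℝ) ^ 2 := by
  induction m generalizing j with
  | zero => cases j <;> simp [shiftedEsymm]
  | succ m ih =>
    cases j with
    | zero => simp [shiftedEsymm]
    | succ j =>
      rcases lt_or_ge m j with hj | hj
      · rw [shiftedEsymm_eq_zero_of_lt b (by omega)]
        simp; positivity
      have hs : |((m : ℝ) - b)| ≤ m + 1 := by
        rw [abs_le]; constructor <;> have := Nat.cast_nonneg (α := ℝ) m <;> linarith
      have i1 := ih (j + 1)
      have i2 := ih j
      rw [Nat.succ_descFactorial_succ]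
      rw [Nat.descFactorial_succ] at i1
      rw [Nat.factorial_succ] at i1 ⊢
      push_cast [Nat.cast_sub hj] at i1 ⊢
      have hjm : (j : ℝ) ≤ m := by exact_mod_cast hj
      have hj0 := Nat.cast_nonneg (α := ℝ) j
      set D : ℝ := (m.descFactorial j : ℝ)
      have e1 : |shiftedEsymm b (m + 1) (j + 1)| ≤
          |shiftedEsymm b m (j + 1)| + (m + 1) * |shiftedEsymm b m j| := by
        refine (abs_add_le _ _).trans ?_
        rw [abs_mul]
        gcongr
      calc _ ≤ (|shiftedEsymm b m (j + 1)| + (m + 1) * |shiftedEsymm b m j|) *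
            ((j + 1) * j.factorial) := by gcongr
        _ = |shiftedEsymm b m (j + 1)| * ((j + 1) * j.factorial) +
            (m + 1) * (j + 1) * (|shiftedEsymm b m j| * j.factorial) := by ring
        _ ≤ ((m - j) * D) ^ 2 + (m + 1) * (j + 1) * D ^ 2 := by gcongr
        _ ≤ ((m + 1) * D) ^ 2 := by
          have : 0 ≤ (m - (j:ℝ)) * (j + 1) := mul_nonneg (by linarith) (by linarith)
          nlinarith [mul_nonneg this (sq_nonneg D)]

lemma tendsto_sum_range_div_choose {f : ℕ → ℝ} {c : ℝ} {p : ℕ}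
    (h : Tendsto (fun n : ℕ => f n / (n.choose p : ℝ)) atTop (𝓝 c)) :
    Tendsto (fun n : ℕ => (∑ i ∈ Finset.range n, f i) / (n.choose (p + 1) : ℝ)) atTop (𝓝 c) := by
  have hs : ∀ n, ∑ i ∈ Finset.range n, (i.choose p : ℝ) = n.choose (p + 1) := by
    intro n
    induction n with
    | zero => simp
    | succ n ih => rw [Finset.sum_range_succ, ih, Nat.choose_succ_succ]; push_cast; ring
  have hne : ∀ q : ℕ, ∀ᶠ n : ℕ in atTop, (n.choose q : ℝ) ≠ 0 := fun q => by
    filter_upwards [eventually_ge_atTop q] with n hn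
    exact_mod_cast (Nat.choose_pos hn).ne'
  have ho : (fun n : ℕ => f n - c * (n.choose p : ℝ)) =o[atTop] fun n : ℕ => (n.choose p : ℝ) := by
    rw [Asymptotics.isLittleO_iff_tendsto' ((hne p).mono fun n hn h => absurd h hn)]
    have := h.sub_const c
    rw [sub_self] at this
    refine this.congr' ?_
    filter_upwards [hne p] with n hn
    field_simp
  have htop : Tendsto (fun n : ℕ => (n.choose (p + 1) : ℝ)) atTop atTop := by
    refine tendsto_natCast_atTop_atTop.comp (tendsto_atTop_mono' _ ?_ (tendsto_sub_atTop_nat p))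
    filter_upwards [eventually_ge_atTop (p + 1)] with n hn
    induction n, hn using Nat.le_induction with
    | base => simp
    | succ n hn ih =>
      rw [Nat.choose_succ_succ']
      have := Nat.choose_pos (n := n) (k := p) (by omega)
      omega
  have ho2 := ho.sum_range (fun n => by positivity) (by simpa only [hs] using htop)
  simp only [hs, Finset.sum_sub_distrib, ← Finset.mul_sum] at ho2
  have := ho2.tendsto_div_nhds_zero.add_const c
  rw [zero_add] at this
  refine this.congr' ?_
  filter_upwards [hne (p + 1)] with n hn
  field_simp
  ring

lemma tendsto_shiftedEsymm_div_choose (b : ℝ) (j : ℕ) :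
    Tendsto (fun n : ℕ => shiftedEsymm b n j / (n.choose (2 * j) : ℝ)) atTop
      (𝓝 ((2 * j).factorial / (2 ^ j * j.factorial))) := by
  induction j with
  | zero => simp [shiftedEsymm_zero_right]
  | succ j ih =>
    have h1 : Tendsto (fun n : ℕ => ((n : ℝ) - b) / (n - 2 * j : ℕ)) atTop (𝓝 1) := by
      have h0 : Asymptotics.IsEquivalent atTop (fun n : ℕ => (n : ℝ) - b) (fun n : ℕ => (n : ℝ)) :=
        Asymptotics.IsEquivalent.sub_isLittleO Asymptotics.IsEquivalent.refl
          (Asymptotics.isLittleO_const_left.2 (Or.inr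
            (tendsto_norm_atTop_atTop.comp tendsto_natCast_atTop_atTop)))
      have h2 : Asymptotics.IsEquivalent atTop (fun n : ℕ => ((n - 2 * j : ℕ) : ℝ))
          (fun n : ℕ => (n : ℝ)) := by
        have : Asymptotics.IsEquivalent atTop (fun n : ℕ => (n : ℝ) - (2 * j : ℕ))
          (fun n : ℕ => (n : ℝ)) :=
          Asymptotics.IsEquivalent.sub_isLittleO Asymptotics.IsEquivalent.refl
            (Asymptotics.isLittleO_const_left.2 (Or.inr
              (tendsto_norm_atTop_atTop.comp tendsto_natCast_atTop_atTop)))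
        refine this.congr_left ?_
        filter_upwards [eventually_ge_atTop (2 * j)] with n hn
        rw [Nat.cast_sub hn]
      refine (Asymptotics.isEquivalent_iff_tendsto_one ?_).1 (h0.trans h2.symm)
      filter_upwards [eventually_gt_atTop (2 * j)] with n hn
      exact_mod_cast (Nat.sub_pos_of_lt hn).ne'
    have h2 : Tendsto (fun n : ℕ => (((n : ℝ) - b) * shiftedEsymm b n j) /
        (n.choose (2 * j + 1) : ℝ)) atTop
        (𝓝 ((2 * j + 1) * ((2 * j).factorial / (2 ^ j * j.factorial)))) := by
      have := (h1.mul ih).const_mul ((2 * j + 1 : ℝ))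
      rw [one_mul] at this
      refine this.congr' ?_
      filter_upwards [eventually_gt_atTop (2 * j)] with n hn
      have e : (n.choose (2 * j + 1) : ℝ) * (2 * j + 1) = n.choose (2 * j) * (n - 2 * j : ℕ) := by
        exact_mod_cast Nat.choose_succ_right_eq n (2 * j)
      have p1 : ((n - 2 * j : ℕ) : ℝ) ≠ 0 := by exact_mod_cast (Nat.sub_pos_of_lt hn).ne'
      have p2 : (n.choose (2 * j) : ℝ) ≠ 0 := by exact_mod_cast (Nat.choose_pos hn.le).ne'
      have p3 : (n.choose (2 * j + 1) : ℝ) ≠ 0 := by exact_mod_cast (Nat.choose_pos hn).ne'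
      field_simp
      rw [mul_comm (n.choose (2 * j) : ℝ), ] at e
      linear_combination (n - b) * shiftedEsymm b n j * e
    have h3 := tendsto_sum_range_div_choose h2
    simp only [← shiftedEsymm_succ_eq_sum] at h3
    have e : ((2 * (j + 1)).factorial : ℝ) / (2 ^ (j + 1) * (j + 1).factorial) =
        (2 * j + 1) * ((2 * j).factorial / (2 ^ j * j.factorial)) := by
      rw [show 2 * (j + 1) = 2 * j + 1 + 1 by ring, Nat.factorial_succ (2 * j + 1),
        Nat.factorial_succ (2 * j), Nat.factorial_succ j]
      push_cast
      field_simp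
      ring
    rw [e]
    exact h3

lemma tendsto_shiftedEsymm_div_descFactorial_sq (b : ℝ) (j : ℕ) :
    Tendsto (fun n : ℕ => shiftedEsymm b n j / (n.descFactorial j : ℝ) ^ 2) atTop
      (𝓝 ((1 / 2) ^ j / j.factorial)) := by
  have h1 : Asymptotics.IsEquivalent atTop (fun n : ℕ => (n.choose (2 * j) : ℝ))
      (fun n : ℕ => (n : ℝ) ^ (2 * j) / (2 * j).factorial) := isEquivalent_choose _
  have h2 : Asymptotics.IsEquivalent atTop (fun n : ℕ => (n.descFactorial j : ℝ) ^ 2)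
      (fun n : ℕ => (n : ℝ) ^ (2 * j)) := by
    simp only [pow_mul']
    exact (isEquivalent_descFactorial j).pow 2
  have h3 : Tendsto (fun n : ℕ => (n.choose (2 * j) : ℝ) / (n.descFactorial j : ℝ) ^ 2) atTop
      (𝓝 (1 / (2 * j).factorial)) := by
    refine (h1.div h2).symm.tendsto_nhds ?_
    refine tendsto_const_nhds.congr' ?_
    filter_upwards [eventually_gt_atTop 0] with n hn
    have : (n : ℝ) ≠ 0 := by positivity
    simp only [Pi.div_apply]
    field_simp
  have h4 := (tendsto_shiftedEsymm_div_choose b j).mul h3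
  have e : ((2 * j).factorial : ℝ) / (2 ^ j * j.factorial) * (1 / (2 * j).factorial) =
      (1 / 2) ^ j / j.factorial := by
    rw [one_div_pow]; field_simp
  rw [e] at h4
  refine h4.congr' ?_
  filter_upwards [eventually_ge_atTop (2 * j)] with n hn
  have p2 : (n.choose (2 * j) : ℝ) ≠ 0 := by exact_mod_cast (Nat.choose_pos hn).ne'
  field_simp

lemma tendsto_ratio_of_eq_sum_shiftedEsymm {b : ℝ} (h0 : 0 ≤ b) (h1 : b ≤ 1) {M r : ℕ → ℝ} {μ : ℝ}
    (hM : ∀ n, 0 < M n)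
    (hlim : Tendsto (fun n : ℕ => ((n : ℝ) + 1) ^ 2 * M n / M (n + 1)) atTop (𝓝 μ))
    (hr : ∀ m, (m.factorial : ℝ) * r m =
      ∑ j ∈ Finset.range (m + 1), (-1) ^ j * shiftedEsymm b m j * M (m - j)) :
    Tendsto (fun n : ℕ => ((n : ℝ) + 1) * r n / r (n + 1)) atTop (𝓝 μ) := by
  have hlim' : Tendsto (fun n : ℕ => ((n : ℝ) + 1) * (M n / n.factorial) /
      (M (n + 1) / (n + 1).factorial)) atTop (𝓝 μ) := by
    refine hlim.congr fun n => ?_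
    have := hM (n + 1)
    rw [Nat.factorial_succ]; push_cast; field_simp
  have hpos : ∀ n, 0 < M n / n.factorial := fun n => div_pos (hM n) (by positivity)
  have key := tendsto_sum_sub_mul_div (r := fun n => M n / n.factorial) hlim' hpos (a := -1 / 2)
    (c := fun n j => (-1) ^ j * shiftedEsymm b n j / n.descFactorial j) (fun n j => by
      have := abs_shiftedEsymm_le h0 h1 n j
      rcases Nat.eq_zero_or_pos (n.descFactorial j) with hz | hz
      · simp [hz]
      have hz' : (0 : ℝ) < n.descFactorial j := by exact_mod_cast hz
      rw [abs_div, abs_mul, abs_pow, abs_neg, abs_one, one_pow, one_mul, Nat.abs_cast,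
        div_mul_eq_mul_div, div_le_iff₀ hz', ← sq]
      exact this) (fun j => by
      have := (tendsto_shiftedEsymm_div_descFactorial_sq b j).const_mul ((-1) ^ j)
      rw [← mul_div_assoc, ← mul_pow, mul_one_div] at this
      refine this.congr fun n => ?_
      rw [div_div, ← sq, mul_div_assoc])
  have hr2 : ∀ m, ∑ j ∈ Finset.range (m + 1), M (m - j) / (m - j).factorial *
      ((-1) ^ j * shiftedEsymm b m j / m.descFactorial j) = r m := by
    intro m
    have hm : (m.factorial : ℝ) ≠ 0 := by positivity
    rw [← mul_right_inj' hm, hr, Finset.mul_sum]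
    refine Finset.sum_congr rfl fun j hj => ?_
    have hj' : j ≤ m := by simpa [Nat.lt_succ_iff] using hj
    rw [← Nat.factorial_mul_descFactorial hj']
    have : (m.descFactorial j : ℝ) ≠ 0 := by exact_mod_cast (Nat.descFactorial_pos.2 hj').ne'
    push_cast
    field_simp
  simp only [hr2] at key
  have k2 := (key.div (key.comp (tendsto_add_atTop_nat 1)) (Real.exp_pos _).ne').mul hlim'
  rw [div_self (Real.exp_pos _).ne', one_mul] at k2
  refine k2.congr fun n => ?_
  have := hpos n
  have := hpos (n + 1)
  have p := hM n
  have p := hM (n + 1)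
  simp only [Pi.div_apply, Function.comp]
  rcases eq_or_ne (r (n + 1)) 0 with hz | hz
  · simp [hz]
  field_simp

end PoissonLimit

lemma hasseDeriv_bernoulli (m n : ℕ) (h : n ≤ m) :
    Polynomial.hasseDeriv n (Polynomial.bernoulli m) =
      (m.choose n : ℚ) • Polynomial.bernoulli (m - n) := by
  ext i
  rw [Polynomial.hasseDeriv_coeff, Polynomial.coeff_smul, Polynomial.coeff_bernoulli,
    Polynomial.coeff_bernoulli]
  by_cases hi : i + n ≤ m
  · rw [if_pos hi, if_pos (by omega), show m - n - i = m - (i + n) by omega, smul_eq_mul]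
    have := Nat.choose_mul (n := m) (Nat.le_add_left n i)
    rw [Nat.add_sub_cancel] at this
    have : (m.choose (i + n) : ℚ) * (i + n).choose n = m.choose n * (m - n).choose i := by
      exact_mod_cast this
    linear_combination _root_.bernoulli (m - (i + n)) * this
  · rw [if_neg hi, if_neg (by omega)]; simp

lemma bernoulli_eval_add (n : ℕ) (x y : ℚ) :
    (Polynomial.bernoulli n).eval (x + y) =
      ∑ j ∈ Finset.range (n + 1), (n.choose j : ℚ) * (Polynomial.bernoulli j).eval x * y ^ (n - j) := by
  have hdeg : (Polynomial.taylor x (Polynomial.bernoulli n)).natDegree < n + 1 := by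
    rw [Polynomial.natDegree_taylor, Nat.lt_succ_iff, Polynomial.natDegree_le_iff_coeff_eq_zero]
    intro N hN
    rw [Polynomial.coeff_bernoulli, if_neg (by omega)]
  rw [add_comm, ← Polynomial.taylor_eval, Polynomial.eval_eq_sum_range' hdeg,
    ← Finset.sum_range_reflect]
  refine Finset.sum_congr rfl fun j hj => ?_
  have hj' : j ≤ n := by simpa [Nat.lt_succ_iff] using hj
  rw [show n + 1 - 1 - j = n - j by omega, Polynomial.taylor_coeff,
    hasseDeriv_bernoulli n (n - j) (by omega), Nat.choose_symm hj', Polynomial.eval_smul,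
    Nat.sub_sub_self hj', smul_eq_mul]

/-- The values at negative integers of the `L`-function of the even character modulo `12`,
up to sign: the moments whose exponential generating function is `(e ^ x - e ^ (5 x)) / (1 + e ^ (6 x))`. -/
noncomputable def twelveMoment (i : ℕ) : ℚ :=
  -(12 ^ i / (i + 1)) * ((Polynomial.bernoulli (i + 1)).eval (1 / 12)
    - (Polynomial.bernoulli (i + 1)).eval (5 / 12) - (Polynomial.bernoulli (i + 1)).eval (7 / 12)
    + (Polynomial.bernoulli (i + 1)).eval (11 / 12))

lemma twelveMoment_even {i : ℕ} (hi : Even i) : twelveMoment i = 0 := by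
  have h : ∀ x : ℚ, (Polynomial.bernoulli (i + 1)).eval (1 - x) =
      -(Polynomial.bernoulli (i + 1)).eval x := by
    intro x
    rw [Polynomial.bernoulli_eval_one_sub, hi.add_one.neg_one_pow, neg_one_mul]
  have h1 := h (1 / 12)
  have h5 := h (5 / 12)
  norm_num at h1 h5
  rw [twelveMoment, h1, h5]
  norm_num

lemma twelveMoment_odd (k : ℕ) : twelveMoment (2 * k + 1) =
    -(12 ^ (2 * k + 1) / (k + 1)) * ((Polynomial.bernoulli (2 * (k + 1))).eval (1 / 12)
      - (Polynomial.bernoulli (2 * (k + 1))).eval (5 / 12)) := by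
  have h : ∀ x : ℚ, (Polynomial.bernoulli (2 * (k + 1))).eval (1 - x) =
      (Polynomial.bernoulli (2 * (k + 1))).eval x := by
    intro x
    rw [Polynomial.bernoulli_eval_one_sub, (even_two_mul _).neg_one_pow, one_mul]
  have h1 := h (1 / 12)
  have h5 := h (5 / 12)
  norm_num at h1 h5
  rw [twelveMoment, show 2 * k + 1 + 1 = 2 * (k + 1) by ring, h1, h5]
  push_cast
  have : (k : ℚ) + 1 ≠ 0 := by positivity
  field_simp
  ring

lemma sum_choose_mul_twelveMoment (i : ℕ) :
    ∑ j ∈ Finset.range (i + 1), (i.choose j : ℚ) * 6 ^ (i - j) * twelveMoment j + twelveMoment i =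
      1 - 5 ^ i := by
  have key : ∀ x : ℚ, ∑ j ∈ Finset.range (i + 1), (i.choose j : ℚ) * 6 ^ (i - j) *
      (12 ^ j / (j + 1) * (Polynomial.bernoulli (j + 1)).eval x) =
      12 ^ i / (i + 1) * ((Polynomial.bernoulli (i + 1)).eval (x + 1 / 2) - (1 / 2) ^ (i + 1)) := by
    intro x
    rw [bernoulli_eval_add, Finset.sum_range_succ' _ (i + 1), Nat.choose_zero_right,
      Polynomial.bernoulli_zero, Polynomial.eval_one, Nat.cast_one, one_mul, one_mul, Nat.sub_zero,
      add_sub_cancel_right, Finset.mul_sum]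
    refine Finset.sum_congr rfl fun j hj => ?_
    have hj' : j ≤ i := by simpa [Nat.lt_succ_iff] using hj
    have h1 : ((i : ℚ) + 1) * i.choose j = (i + 1).choose (j + 1) * (j + 1) := by
      exact_mod_cast Nat.add_one_mul_choose_eq i j
    have h2 : (12 : ℚ) ^ i = 12 ^ (i - j) * 12 ^ j := by rw [← pow_add, Nat.sub_add_cancel hj']
    have h3 : (6 : ℚ) ^ (i - j) = 12 ^ (i - j) * (1 / 2) ^ (i - j) := by
      rw [← mul_pow]; norm_num
    have hi0 : (i : ℚ) + 1 ≠ 0 := by positivity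
    have hj0 : (j : ℚ) + 1 ≠ 0 := by positivity
    rw [h2, h3, Nat.add_sub_add_right]
    field_simp
    linear_combination (Polynomial.bernoulli (j + 1)).eval x * h1
  have hs : ∀ x : ℚ, (Polynomial.bernoulli (i + 1)).eval (1 + x) =
      (Polynomial.bernoulli (i + 1)).eval x + (i + 1) * x ^ i := by
    intro x; rw [Polynomial.bernoulli_eval_one_add]; simp
  have e : ∑ j ∈ Finset.range (i + 1), (i.choose j : ℚ) * 6 ^ (i - j) * twelveMoment j =
      -(12 ^ i / (i + 1)) * ((Polynomial.bernoulli (i + 1)).eval (1 / 12 + 1 / 2)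
    - (Polynomial.bernoulli (i + 1)).eval (5 / 12 + 1 / 2)
    - (Polynomial.bernoulli (i + 1)).eval (7 / 12 + 1 / 2)
    + (Polynomial.bernoulli (i + 1)).eval (11 / 12 + 1 / 2)) := by
    have := congrArg₂ (· + ·) (congrArg₂ (· - ·) (congrArg₂ (· - ·) (key (1 / 12)) (key (5 / 12)))
      (key (7 / 12))) (key (11 / 12))
    rw [← Finset.sum_sub_distrib, ← Finset.sum_sub_distrib, ← Finset.sum_add_distrib] at this
    trans -(12 ^ i / (i + 1) * ((Polynomial.bernoulli (i + 1)).eval (1 / 12 + 1 / 2) - (1 / 2) ^ (i + 1)) -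
          12 ^ i / (i + 1) * ((Polynomial.bernoulli (i + 1)).eval (5 / 12 + 1 / 2) - (1 / 2) ^ (i + 1)) -
        12 ^ i / (i + 1) * ((Polynomial.bernoulli (i + 1)).eval (7 / 12 + 1 / 2) - (1 / 2) ^ (i + 1)) +
      12 ^ i / (i + 1) * ((Polynomial.bernoulli (i + 1)).eval (11 / 12 + 1 / 2) - (1 / 2) ^ (i + 1)))
    · rw [← this, ← Finset.sum_neg_distrib]
      refine Finset.sum_congr rfl fun j _ => ?_
      rw [twelveMoment]; ring
    · ring
  rw [e, twelveMoment, show (7 / 12 + 1 / 2 : ℚ) = 1 + 1 / 12 by norm_num,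
    show (11 / 12 + 1 / 2 : ℚ) = 1 + 5 / 12 by norm_num, hs, hs,
    show (1 / 12 + 1 / 2 : ℚ) = 7 / 12 by norm_num, show (5 / 12 + 1 / 2 : ℚ) = 11 / 12 by norm_num]
  have hi0 : (i : ℚ) + 1 ≠ 0 := by positivity
  rw [div_pow, div_pow]
  field_simp
  ring

section MomentFunctional

variable (A : Type*) [CommRing A] [Algebra ℝ A]

/-- The `A`-linear functional on `A[X]` with moments `twelveMoment`. -/
noncomputable def momentFunctional : Polynomial A →ₗ[A] A :=
  Polynomial.lsum fun i => algebraMap ℝ A (twelveMoment i) • LinearMap.id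

/-- The functional `momentFunctional` applied to each coefficient of a power series. -/
noncomputable def seriesMoment : PowerSeries (Polynomial A) →+ PowerSeries A where
  toFun F := PowerSeries.mk fun n => momentFunctional A (PowerSeries.coeff n F)
  map_zero' := by ext; simp
  map_add' F G := by ext; simp

variable {A}

@[simp]
lemma momentFunctional_monomial (i : ℕ) (a : A) :
    momentFunctional A (Polynomial.monomial i a) = algebraMap ℝ A (twelveMoment i) * a := by
  simp [momentFunctional, Polynomial.lsum_apply, Algebra.smul_def]

lemma momentFunctional_C_mul (a : A) (f : Polynomial A) :
    momentFunctional A (Polynomial.C a * f) = a * momentFunctional A f := by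
  rw [← Polynomial.smul_eq_C_mul, map_smul, smul_eq_mul]

lemma momentFunctional_expand (f : Polynomial A) :
    momentFunctional A (Polynomial.expand A 2 f) = 0 := by
  induction f using Polynomial.induction_on' with
  | add p q hp hq => rw [map_add, map_add, hp, hq, add_zero]
  | monomial i a => simp [Polynomial.expand_monomial, twelveMoment_even (even_two.mul_left i)]

lemma momentFunctional_map {B : Type*} [CommRing B] [Algebra ℝ B] (φ : A →ₐ[ℝ] B)
    (f : Polynomial A) :
    momentFunctional B (f.map (φ : A →+* B)) = φ (momentFunctional A f) := by
  induction f using Polynomial.induction_on' with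
  | add p q hp hq => rw [Polynomial.map_add, map_add, map_add, map_add, hp, hq]
  | monomial i a => simp

lemma momentFunctional_taylor (f : Polynomial A) :
    momentFunctional A (Polynomial.taylor 6 f) + momentFunctional A f = f.eval 1 - f.eval 5 := by
  induction f using Polynomial.induction_on' with
  | add p q hp hq =>
    simp only [map_add, Polynomial.eval_add]
    linear_combination hp + hq
  | monomial i a =>
    have h : Polynomial.taylor 6 (Polynomial.monomial i a) =
        ∑ j ∈ Finset.range (i + 1), Polynomial.monomial j (a * (6 ^ (i - j) * i.choose j)) := by
      rw [Polynomial.taylor_monomial, add_pow, Finset.mul_sum]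
      refine Finset.sum_congr rfl fun j _ => ?_
      rw [← Polynomial.C_mul_X_pow_eq_monomial]
      simp only [map_mul, map_pow, map_natCast]
      ring
    have hm := congrArg (fun q : ℚ => algebraMap ℝ A (q : ℝ)) (sum_choose_mul_twelveMoment i)
    simp only [Rat.cast_add, Rat.cast_sum, Rat.cast_mul, Rat.cast_sub, Rat.cast_pow,
      Rat.cast_natCast, Rat.cast_ofNat, Rat.cast_one, map_add, map_sum, map_mul, map_sub, map_pow,
      map_natCast, map_ofNat, map_one] at hm
    rw [h, map_sum]
    simp only [momentFunctional_monomial, Polynomial.eval_monomial, one_pow, mul_one]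
    rw [show a - a * 5 ^ i = a * (1 - 5 ^ i) by ring, ← hm, mul_add, Finset.mul_sum]
    congr 1
    · exact Finset.sum_congr rfl fun j _ => by ring
    · ring

@[simp]
lemma coeff_seriesMoment (n : ℕ) (F : PowerSeries (Polynomial A)) :
    PowerSeries.coeff n (seriesMoment A F) = momentFunctional A (PowerSeries.coeff n F) := by
  simp [seriesMoment]

lemma seriesMoment_map_C_mul (f : PowerSeries A) (F : PowerSeries (Polynomial A)) :
    seriesMoment A (PowerSeries.map Polynomial.C f * F) = f * seriesMoment A F := by
  ext n
  simp [PowerSeries.coeff_mul, momentFunctional_C_mul]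

lemma seriesMoment_taylor (F : PowerSeries (Polynomial A)) :
    seriesMoment A (PowerSeries.map (Polynomial.taylorAlgHom (6 : A)).toRingHom F) +
      seriesMoment A F =
    PowerSeries.map (Polynomial.evalRingHom 1) F - PowerSeries.map (Polynomial.evalRingHom 5) F := by
  ext n
  simpa using momentFunctional_taylor (PowerSeries.coeff n F)

lemma seriesMoment_map {B : Type*} [CommRing B] [Algebra ℝ B] (φ : A →ₐ[ℝ] B)
    (F : PowerSeries (Polynomial A)) :
    seriesMoment B (PowerSeries.map (Polynomial.mapRingHom (φ : A →+* B)) F) =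
      PowerSeries.map (φ : A →+* B) (seriesMoment A F) := by
  ext n
  simpa using momentFunctional_map φ (PowerSeries.coeff n F)

lemma seriesMoment_expand (F : PowerSeries (Polynomial A)) :
    seriesMoment A (PowerSeries.map (Polynomial.expand A 2).toRingHom F) = 0 := by
  ext n
  simpa using momentFunctional_expand (PowerSeries.coeff n F)

end MomentFunctional

section BinomialSeries

open PowerSeries

lemma map_binomialSeries {R S : Type*} [CommRing R] [CommRing S] [BinomialRing R] [BinomialRing S]
    (φ : R →+* S) (z : R) :
    map φ (binomialSeries R z) = binomialSeries S (φ z) := by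
  ext n
  simp [Ring.map_choose]

lemma prod_range_sub_natCast {R : Type*} [CommRing R] [BinomialRing R] (z : R) (n : ℕ) :
    (n.factorial : R) * Ring.choose z n = ∏ i ∈ Finset.range n, (z - i) := by
  rw [← nsmul_eq_mul, ← Ring.descPochhammer_eq_factorial_smul_choose,
    ← Polynomial.aeval_eq_smeval, Polynomial.aeval_def, ← Polynomial.eval_map, descPochhammer_map]
  exact descPochhammer_eval_eq_prod_range n z

lemma binomialSeries_one_add_X {R : Type*} [CommRing R] [BinomialRing R] : binomialSeries R (1 : R) = 1 + X := by
  simpa using binomialSeries_nat (R := R) (A := R) 1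

lemma X_dvd_one_sub_binomialSeries {R : Type*} [CommRing R] [BinomialRing R] (z : R) : (X : PowerSeries R) ∣ 1 - binomialSeries R z := by
  rw [X_dvd_iff]; simp

/-- The power series `((1 + X) ^ z - 1) / z`. -/
noncomputable def binomialSeriesQuot {R : Type*} [CommRing R] [Algebra ℝ R] [BinomialRing R]
    (z : R) : PowerSeries R :=
  mk fun k => if k = 0 then 0 else algebraMap ℝ R (1 / k) * Ring.choose (z - 1) (k - 1)

variable {R : Type*} [CommRing R] [Algebra ℝ R] [BinomialRing R]

lemma binomialSeries_eq_one_add (z : R) :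
    binomialSeries R z = 1 + C z * binomialSeriesQuot z := by
  ext n
  rcases n with _ | k
  · simp [binomialSeriesQuot]
  · simp only [binomialSeries_coeff, smul_eq_mul, mul_one, map_add, coeff_C_mul,
      binomialSeriesQuot, coeff_mk, if_neg (Nat.succ_ne_zero k), Nat.add_sub_cancel, coeff_one,
      zero_add]
    have h1 := prod_range_sub_natCast z (k + 1)
    have h2 := prod_range_sub_natCast (z - 1) k
    rw [Finset.prod_range_succ'] at h1
    have h3 : ∏ i ∈ Finset.range k, (z - ((i + 1 : ℕ) : R)) =
        ∏ i ∈ Finset.range k, (z - 1 - (i : R)) :=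
      Finset.prod_congr rfl fun i _ => by push_cast; ring
    rw [h3, ← h2] at h1
    have hk : algebraMap ℝ R (1 / (k + 1 : ℕ)) * algebraMap ℝ R (1 / k.factorial) *
        ((k + 1).factorial : R) = 1 := by
      rw [← map_natCast (algebraMap ℝ R), ← map_mul, ← map_mul, ← map_one (algebraMap ℝ R),
        Nat.factorial_succ]
      congr 1
      have := Nat.factorial_ne_zero k
      push_cast
      field_simp
    have hk' : algebraMap ℝ R (1 / k.factorial) * (k.factorial : R) = 1 := by
      rw [← map_natCast (algebraMap ℝ R), ← map_mul, ← map_one (algebraMap ℝ R)]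
      congr 1
      have := Nat.factorial_ne_zero k
      field_simp
    push_cast at h1 hk ⊢
    linear_combination (algebraMap ℝ R (1 / (k + 1)) * algebraMap ℝ R (1 / k.factorial)) * h1 -
      Ring.choose z (k + 1) * hk +
      (algebraMap ℝ R (1 / (k + 1)) * z * Ring.choose (z - 1) k) * hk'

lemma map_binomialSeriesQuot {S : Type*} [CommRing S] [Algebra ℝ S] [BinomialRing S]
    (φ : R →ₐ[ℝ] S) (z : R) :
    map (φ : R →+* S) (binomialSeriesQuot z) = binomialSeriesQuot (φ z) := by
  ext n
  by_cases h : n = 0 <;> simp [binomialSeriesQuot, Ring.map_choose, h]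

lemma exists_binomialSeriesQuot_zero_eq :
    ∃ v : PowerSeries ℝ, IsUnit v ∧ binomialSeriesQuot (0 : ℝ) = X * v := by
  refine ⟨mk fun k => 1 / (k + 1) * Ring.choose (0 - 1 : ℝ) k, ?_, ?_⟩
  · rw [PowerSeries.isUnit_iff_constantCoeff]
    simp [← coeff_zero_eq_constantCoeff_apply]
  · ext n
    rcases n with _ | n
    · simp [binomialSeriesQuot]
    · simp [binomialSeriesQuot, coeff_succ_X_mul]

end BinomialSeries

/-- A partial sum of Zagier's auxiliary series `∑ (1 - q x) ⋯ (1 - q ^ n x) x ^ n`. -/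
def zagierSum {R : Type*} [CommRing R] (q x : R) (N : ℕ) : R :=
  ∑ n ∈ Finset.range N, (∏ i ∈ Finset.range n, (1 - q ^ (i + 1) * x)) * x ^ n

lemma one_sub_mul_zagierSum {R : Type*} [CommRing R] (q x : R) (N : ℕ) :
    (1 - x) * zagierSum q x N =
      1 - q * x ^ 2 - q ^ 2 * x ^ 3 * ((1 - q * x) * zagierSum q (q * x) N) +
        (∏ i ∈ Finset.range N, (1 - q ^ (i + 1) * x)) * (q ^ (N + 1) * x ^ (N + 2) - x ^ N) := by
  induction N with
  | zero => simp [zagierSum]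
  | succ N ih =>
    have h : (1 - q * x) * ∏ i ∈ Finset.range N, (1 - q ^ (i + 1) * (q * x)) =
        (∏ i ∈ Finset.range N, (1 - q ^ (i + 1) * x)) * (1 - q ^ (N + 1) * x) := by
      rw [← Finset.prod_range_succ, Finset.prod_range_succ', mul_comm]
      congr 1
      · exact Finset.prod_congr rfl fun i _ => by ring
      · ring
    unfold zagierSum at ih ⊢
    rw [Finset.sum_range_succ, Finset.sum_range_succ, mul_add, ih, Finset.prod_range_succ _ N]
    linear_combination (-q ^ 2 * x ^ 3 * (q * x) ^ N) * (-h)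

section ZagierIdentity

open PowerSeries

lemma eq_zero_of_add_taylor_one_eq_zero {c : Polynomial ℝ} (h : c + Polynomial.taylor 1 c = 0) :
    c = 0 := by
  have h1 := congrArg (Polynomial.coeff · c.natDegree) h
  have h2 : (Polynomial.taylor 1 c).coeff c.natDegree = c.leadingCoeff := by
    rw [← Polynomial.leadingCoeff_taylor (r := 1), Polynomial.leadingCoeff,
      Polynomial.natDegree_taylor]
  simp only [Polynomial.coeff_add, Polynomial.coeff_zero, h2, Polynomial.coeff_natDegree] at h1
  exact Polynomial.leadingCoeff_eq_zero.1 (by linarith)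

lemma X_pow_dvd_of_add_mul_map_taylor {N : ℕ} {B D : PowerSeries (Polynomial ℝ)}
    (hB : constantCoeff B = 1)
    (h : X ^ N ∣ D + B * map (Polynomial.taylorAlgHom (1 : ℝ)).toRingHom D) : X ^ N ∣ D := by
  rw [X_pow_dvd_iff] at h ⊢
  intro n
  induction n using Nat.strong_induction_on with
  | _ n ih =>
    intro hn
    have hz := h n hn
    rw [map_add, coeff_mul, Finset.sum_eq_single (0, n)] at hz
    · apply eq_zero_of_add_taylor_one_eq_zero
      simpa [hB] using hz
    · rintro ⟨i, j⟩ hij hne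
      rw [Finset.HasAntidiagonal.mem_antidiagonal] at hij
      have : j < n := by
        rcases Nat.eq_zero_or_pos i with rfl | hi
        · exact absurd (by simpa using hij) (fun h' : j = n => hne (by rw [h']))
        · dsimp only at hij; omega
      simp [ih j this (this.trans hn)]
    · intro h'
      simp at h'

/-- The exponent `u (x - 1) / 2 + (x ^ 2 - 1) / 24`, as a polynomial in `x` over `ℝ[u]`. -/
noncomputable def thetaExponent : Polynomial (Polynomial ℝ) :=
  Polynomial.C Polynomial.X * (Polynomial.C (Polynomial.C (1 / 2)) * (Polynomial.X - 1)) +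
    Polynomial.C (Polynomial.C (1 / 24)) * (Polynomial.X ^ 2 - 1)

lemma taylor_thetaExponent :
    Polynomial.taylor 6 thetaExponent =
      thetaExponent.map (Polynomial.taylorAlgHom (1 : ℝ)).toRingHom +
        Polynomial.C (3 * Polynomial.X + 2) := by
  have h2 : (2 : Polynomial (Polynomial ℝ)) * Polynomial.C (Polynomial.C (1 / 2)) = 1 := by
    rw [show (2 : Polynomial (Polynomial ℝ)) = Polynomial.C (Polynomial.C 2) from rfl, ← map_mul,
      ← map_mul]
    norm_num
  have h24 : (12 : Polynomial (Polynomial ℝ)) * Polynomial.C (Polynomial.C (1 / 24)) =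
      Polynomial.C (Polynomial.C (1 / 2)) := by
    rw [show (12 : Polynomial (Polynomial ℝ)) = Polynomial.C (Polynomial.C 12) from rfl, ← map_mul,
      ← map_mul]
    norm_num
  simp only [thetaExponent, AlgHom.toRingHom_eq_coe, map_add, Polynomial.taylor_mul,
    Polynomial.taylor_C, map_sub, Polynomial.taylor_X, Polynomial.taylor_one,
    Polynomial.taylor_pow, Polynomial.map_add, Polynomial.map_mul, Polynomial.map_C,
    RingHom.coe_coe, Polynomial.taylorAlgHom_apply, Polynomial.map_sub, Polynomial.map_X,
    Polynomial.map_one, Polynomial.map_pow, map_mul, map_ofNat, map_one]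
  linear_combination (3 * Polynomial.C Polynomial.X + 2) * h2 + (Polynomial.X + 3) * h24

lemma eval_one_thetaExponent : thetaExponent.eval 1 = 0 := by
  simp [thetaExponent]

lemma eval_five_thetaExponent : thetaExponent.eval 5 = 2 * Polynomial.X + 1 := by
  have h2 : (2 : Polynomial ℝ) * Polynomial.C (1 / 2) = 1 := by
    rw [show (2 : Polynomial ℝ) = Polynomial.C 2 from rfl, ← map_mul]
    norm_num
  have h24 : (24 : Polynomial ℝ) * Polynomial.C (1 / 24) = 1 := by
    rw [show (24 : Polynomial ℝ) = Polynomial.C 24 from rfl, ← map_mul]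
    norm_num
  simp only [thetaExponent, Polynomial.eval_add, Polynomial.eval_mul, Polynomial.eval_C,
    Polynomial.eval_sub, Polynomial.eval_X, Polynomial.eval_one, Polynomial.eval_pow]
  linear_combination 2 * Polynomial.X * h2 + h24

lemma seriesMoment_thetaExponent :
    seriesMoment (Polynomial ℝ) (binomialSeries (Polynomial (Polynomial ℝ)) (-thetaExponent)) +
      binomialSeries (Polynomial ℝ) (-(3 * Polynomial.X + 2) : Polynomial ℝ) *
        map (Polynomial.taylorAlgHom (1 : ℝ)).toRingHom
          (seriesMoment (Polynomial ℝ) (binomialSeries (Polynomial (Polynomial ℝ)) (-thetaExponent))) =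
      1 - binomialSeries (Polynomial ℝ) (-(2 * Polynomial.X + 1) : Polynomial ℝ) := by
  have h := seriesMoment_taylor (binomialSeries (Polynomial (Polynomial ℝ)) (-thetaExponent))
  rw [map_binomialSeries, map_binomialSeries, map_binomialSeries] at h
  have h1 : (Polynomial.taylorAlgHom (6 : Polynomial ℝ)).toRingHom (-thetaExponent) =
      Polynomial.C (-(3 * Polynomial.X + 2)) +
        Polynomial.mapRingHom (Polynomial.taylorAlgHom (1 : ℝ)).toRingHom (-thetaExponent) := by
    have := taylor_thetaExponent
    simp only [AlgHom.toRingHom_eq_coe, RingHom.coe_coe, Polynomial.taylorAlgHom_apply, map_neg,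
      Polynomial.coe_mapRingHom] at this ⊢
    rw [this]; ring
  rw [h1, binomialSeries_add, ← map_binomialSeries Polynomial.C,

    ← map_binomialSeries (Polynomial.mapRingHom (Polynomial.taylorAlgHom (1 : ℝ)).toRingHom)
      (-thetaExponent), seriesMoment_map_C_mul] at h
  have h2 := seriesMoment_map (Polynomial.taylorAlgHom (1 : ℝ)) (binomialSeries (Polynomial (Polynomial ℝ)) (-thetaExponent))
  simp only [AlgHom.toRingHom_eq_coe] at h ⊢
  rw [h2] at h
  simp only [Polynomial.coe_evalRingHom, Polynomial.eval_neg, eval_one_thetaExponent,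
    eval_five_thetaExponent, neg_zero, binomialSeries_zero] at h
  linear_combination h

lemma X_pow_dvd_zagierSum_sub_seriesMoment (N : ℕ) :
    (X : PowerSeries (Polynomial ℝ)) ^ N ∣
      (1 - binomialSeries (Polynomial ℝ) (-Polynomial.X : Polynomial ℝ)) *
        zagierSum (binomialSeries (Polynomial ℝ) (-1 : Polynomial ℝ))
          (binomialSeries (Polynomial ℝ) (-Polynomial.X : Polynomial ℝ)) N -
      seriesMoment (Polynomial ℝ) (binomialSeries (Polynomial (Polynomial ℝ)) (-thetaExponent)) := by
  apply X_pow_dvd_of_add_mul_map_taylor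
    (B := binomialSeries (Polynomial ℝ) (-(3 * Polynomial.X + 2) : Polynomial ℝ))
  · simp
  set p := binomialSeries (Polynomial ℝ) (-1 : Polynomial ℝ) with hp
  set x := binomialSeries (Polynomial ℝ) (-Polynomial.X : Polynomial ℝ) with hx
  have hσp : map (Polynomial.taylorAlgHom (1 : ℝ)).toRingHom p = p := by
    rw [hp, map_binomialSeries]; simp
  have hσx : map (Polynomial.taylorAlgHom (1 : ℝ)).toRingHom x = p * x := by
    rw [hp, hx, map_binomialSeries, ← binomialSeries_add]
    congr 1
    simp
  have hW : map (Polynomial.taylorAlgHom (1 : ℝ)).toRingHom (zagierSum p x N) =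
      zagierSum p (p * x) N := by
    simp only [zagierSum, map_sum, map_mul, map_prod, map_sub, map_one, map_pow, hσp, hσx]
  have h3 : binomialSeries (Polynomial ℝ) (-(3 * Polynomial.X + 2) : Polynomial ℝ) = p ^ 2 * x ^ 3 := by
    rw [show -(3 * Polynomial.X + 2) = -1 + -1 + (-Polynomial.X + -Polynomial.X + -Polynomial.X)
      by ring]
    simp only [binomialSeries_add, ← hp, ← hx]; ring
  have h2 : binomialSeries (Polynomial ℝ) (-(2 * Polynomial.X + 1) : Polynomial ℝ) = p * x ^ 2 := by
    rw [show -(2 * Polynomial.X + 1) = -1 + (-Polynomial.X + -Polynomial.X) by ring]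
    simp only [binomialSeries_add, ← hp, ← hx]; ring
  have key := seriesMoment_thetaExponent
  rw [h3, h2] at key
  rw [h3, map_sub, map_mul, map_sub, map_one, hW, hσx]
  have hfin := one_sub_mul_zagierSum p x N
  have hdvd : X ^ N ∣ ∏ i ∈ Finset.range N, (1 - p ^ (i + 1) * x) := by
    rw [← Finset.card_range N, ← Finset.prod_const, Finset.card_range]
    refine Finset.prod_dvd_prod_of_dvd _ _ fun i _ => ?_
    rw [X_dvd_iff]
    simp [hp, hx]
  convert! hdvd.mul_right (p ^ (N + 1) * x ^ (N + 2) - x ^ N) using 1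
  linear_combination hfin - key

end ZagierIdentity

section ZagierCoefficients

open PowerSeries

/-- The polynomial `(X - 1) / 2`. -/
noncomputable def alphaPoly (A : Type*) [CommRing A] [Algebra ℝ A] : Polynomial A :=
  Polynomial.C (algebraMap ℝ A (1 / 2)) * (Polynomial.X - 1)

/-- The polynomial `(X ^ 2 - 1) / 24`. -/
noncomputable def betaPoly (A : Type*) [CommRing A] [Algebra ℝ A] : Polynomial A :=
  Polynomial.C (algebraMap ℝ A (1 / 24)) * (Polynomial.X ^ 2 - 1)

lemma thetaExponent_eq :
    thetaExponent = Polynomial.C Polynomial.X * alphaPoly (Polynomial ℝ) +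
      betaPoly (Polynomial ℝ) := rfl

lemma map_alphaPoly {A B : Type*} [CommRing A] [Algebra ℝ A] [CommRing B] [Algebra ℝ B]
    (φ : A →ₐ[ℝ] B) : (alphaPoly A).map (φ : A →+* B) = alphaPoly B := by
  simp [alphaPoly]

lemma map_betaPoly {A B : Type*} [CommRing A] [Algebra ℝ A] [CommRing B] [Algebra ℝ B]
    (φ : A →ₐ[ℝ] B) : (betaPoly A).map (φ : A →+* B) = betaPoly B := by
  simp [betaPoly]

lemma seriesMoment_evenExponent {A : Type*} [CommRing A] [Algebra ℝ A] [BinomialRing (Polynomial A)] :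
    seriesMoment A (PowerSeries.binomialSeries (Polynomial A)
      (-betaPoly A)) = 0 := by
  have h := seriesMoment_expand (PowerSeries.binomialSeries (Polynomial A)
      (-(Polynomial.C (algebraMap ℝ A (1 / 24)) * (Polynomial.X - 1))))
  have hβ : (Polynomial.expand A 2).toRingHom
      (-(Polynomial.C (algebraMap ℝ A (1 / 24)) * (Polynomial.X - 1))) = -betaPoly A := by
    simp [betaPoly]
  rwa [map_binomialSeries, hβ] at h

lemma X_pow_dvd_of_dvd_C_X_mul {N : ℕ} {F : PowerSeries (Polynomial ℝ)}
    (h : X ^ N ∣ C Polynomial.X * F) : X ^ N ∣ F := by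
  rw [X_pow_dvd_iff] at h ⊢
  intro n hn
  have := h n hn
  rw [coeff_C_mul] at this
  exact (mul_eq_zero.1 this).resolve_left Polynomial.X_ne_zero

lemma X_pow_dvd_binomialSeriesQuot_mul_add (N : ℕ) :
    (X : PowerSeries (Polynomial ℝ)) ^ N ∣
      binomialSeriesQuot (-Polynomial.X : Polynomial ℝ) *
        zagierSum (PowerSeries.binomialSeries (Polynomial ℝ) (-1 : Polynomial ℝ))
          (PowerSeries.binomialSeries (Polynomial ℝ) (-Polynomial.X : Polynomial ℝ)) N +
      seriesMoment (Polynomial ℝ)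
        (C (alphaPoly (Polynomial ℝ)) *
          binomialSeriesQuot (-(Polynomial.C Polynomial.X *
            alphaPoly (Polynomial ℝ))) *
          PowerSeries.binomialSeries (Polynomial (Polynomial ℝ))
            (-betaPoly (Polynomial ℝ))) := by
  apply X_pow_dvd_of_dvd_C_X_mul
  have h := X_pow_dvd_zagierSum_sub_seriesMoment N
  have hθ : -thetaExponent = -betaPoly (Polynomial ℝ) +
      -(Polynomial.C Polynomial.X * alphaPoly (Polynomial ℝ)) := by
    rw [thetaExponent_eq]; ring
  have heven := seriesMoment_evenExponent (A := Polynomial ℝ)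
  have key : seriesMoment (Polynomial ℝ)
      (PowerSeries.binomialSeries (Polynomial (Polynomial ℝ)) (-thetaExponent)) =
      -(C Polynomial.X * seriesMoment (Polynomial ℝ)
        (C (alphaPoly (Polynomial ℝ)) *
          binomialSeriesQuot (-(Polynomial.C Polynomial.X *
            alphaPoly (Polynomial ℝ))) *
          PowerSeries.binomialSeries (Polynomial (Polynomial ℝ))
            (-betaPoly (Polynomial ℝ)))) := by
    rw [hθ, binomialSeries_add, binomialSeries_eq_one_add (-(Polynomial.C Polynomial.X *
            alphaPoly (Polynomial ℝ))), mul_add, map_add, mul_one,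
      heven, zero_add, ← seriesMoment_map_C_mul, ← map_neg]
    congr 1
    rw [map_neg, map_mul C (Polynomial.C Polynomial.X), map_C]
    ring
  convert! h using 1
  rw [key]
  rw [binomialSeries_eq_one_add (-Polynomial.X : Polynomial ℝ), map_neg]
  ring

lemma X_pow_dvd_sum_prod_add_seriesMoment (N : ℕ) :
    (X : PowerSeries ℝ) ^ N ∣
      ∑ n ∈ Finset.range (N + 1), ∏ i ∈ Finset.range n,
        (1 - PowerSeries.binomialSeries ℝ (-1 : ℝ) ^ (i + 1)) +
      seriesMoment ℝ (C (alphaPoly ℝ) *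
          PowerSeries.binomialSeries (Polynomial ℝ)
            (-betaPoly ℝ)) := by
  let φ : Polynomial ℝ →ₐ[ℝ] ℝ := Polynomial.aeval 0
  have hφX : φ Polynomial.X = 0 := by simp [φ]
  have hφC : ∀ r, φ (Polynomial.C r) = r := by simp [φ]
  have hφ' : ∀ f, (φ : Polynomial ℝ →+* ℝ) f = φ f := fun _ => rfl
  obtain ⟨V, hV⟩ := X_pow_dvd_binomialSeriesQuot_mul_add (N + 1)
  have h := congrArg (PowerSeries.map (φ : Polynomial ℝ →+* ℝ)) hV
  rw [map_add, map_mul, map_binomialSeriesQuot, ← seriesMoment_map,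
    map_mul (map (Polynomial.mapRingHom (φ : Polynomial ℝ →+* ℝ))),
    map_mul (map (Polynomial.mapRingHom (φ : Polynomial ℝ →+* ℝ))),
    map_mul (map (φ : Polynomial ℝ →+* ℝ)), map_pow, map_X] at h
  have hψ := map_binomialSeriesQuot (Polynomial.mapAlgHom φ) (-(Polynomial.C Polynomial.X *
            alphaPoly (Polynomial ℝ)) : Polynomial (Polynomial ℝ))
  have hψ' : ((Polynomial.mapAlgHom φ : Polynomial (Polynomial ℝ) →ₐ[ℝ] Polynomial ℝ) :
      Polynomial (Polynomial ℝ) →+* Polynomial ℝ) = Polynomial.mapRingHom (φ : Polynomial ℝ →+* ℝ) := rfl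
  have h0 : Polynomial.mapAlgHom φ (-(Polynomial.C Polynomial.X *
            alphaPoly (Polynomial ℝ))) =
        Polynomial.CAlgHom (R := ℝ) (A := ℝ) 0 := by
    simp [hφX]
  rw [hψ', h0, ← map_binomialSeriesQuot] at hψ
  rw [hψ, map_binomialSeries, map_C, map_neg, hφX, neg_zero] at h
  have hW : map (φ : Polynomial ℝ →+* ℝ) (zagierSum (PowerSeries.binomialSeries (Polynomial ℝ) (-1 : Polynomial ℝ))
          (PowerSeries.binomialSeries (Polynomial ℝ) (-Polynomial.X : Polynomial ℝ)) (N + 1)) =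
      ∑ n ∈ Finset.range (N + 1), ∏ i ∈ Finset.range n,
        (1 - PowerSeries.binomialSeries ℝ (-1 : ℝ) ^ (i + 1)) := by
    simp only [zagierSum, map_sum, map_mul, map_prod, map_sub, map_one, map_pow, map_binomialSeries,
      map_neg, hφ', hφX, neg_zero, binomialSeries_zero, mul_one, one_pow]
  rw [hW] at h
  have e1 : Polynomial.mapRingHom (φ : Polynomial ℝ →+* ℝ) (alphaPoly (Polynomial ℝ)) =
      alphaPoly ℝ := map_alphaPoly φ
  have e2 : Polynomial.mapRingHom (φ : Polynomial ℝ →+* ℝ) (-betaPoly (Polynomial ℝ)) =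
      -betaPoly ℝ := by rw [map_neg]; exact congrArg _ (map_betaPoly φ)
  rw [e1, e2, show ∀ a b c : PowerSeries (Polynomial ℝ), a * b * c = b * (a * c) from
    fun a b c => by ring] at h
  have e3 := seriesMoment_map_C_mul (binomialSeriesQuot (0 : ℝ))
    (C (alphaPoly ℝ) * PowerSeries.binomialSeries (Polynomial ℝ)
            (-betaPoly ℝ))
  have e4 : ((Polynomial.CAlgHom (R := ℝ) (A := ℝ)) : ℝ →+* Polynomial ℝ) = Polynomial.C := rfl
  rw [e4, e3, ← mul_add] at h
  obtain ⟨v, ⟨v, rfl⟩, hv⟩ := exists_binomialSeriesQuot_zero_eq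
  rw [hv, pow_succ', mul_assoc, mul_assoc] at h
  have h5 := mul_left_cancel₀ X_ne_zero h
  refine ⟨↑v⁻¹ * map (φ : Polynomial ℝ →+* ℝ) V, ?_⟩
  rw [mul_left_comm, ← h5, Units.inv_mul_cancel_left]

/-- The coefficients of the expansion of `m! r m` in elementary symmetric polynomials, for `r m` the
number of rigid unlabelled interval orders on `m` points. -/
noncomputable def rigidMoment (k : ℕ) : ℝ :=
  -(1 / 2) * (-1 / 24) ^ k * twelveMoment (2 * k + 1)

lemma momentFunctional_alphaPoly_mul (k : ℕ) :
    momentFunctional ℝ (alphaPoly ℝ * (-(Polynomial.C (1 / 24) * Polynomial.X ^ 2)) ^ k) =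
      -rigidMoment k := by
  have h : alphaPoly ℝ * (-(Polynomial.C (1 / 24) * Polynomial.X ^ 2)) ^ k =
      Polynomial.monomial (2 * k + 1) (1 / 2 * (-1 / 24) ^ k) -
      Polynomial.monomial (2 * k) (1 / 2 * (-1 / 24) ^ k) := by
    rw [alphaPoly, ← neg_mul, ← map_neg, mul_pow, ← map_pow, ← pow_mul,
      ← Polynomial.C_mul_X_pow_eq_monomial, ← Polynomial.C_mul_X_pow_eq_monomial, neg_div, map_mul]
    simp only [Algebra.algebraMap_self, RingHom.id_apply]
    ring
  rw [h, map_sub, momentFunctional_monomial, momentFunctional_monomial,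
    twelveMoment_even (even_two_mul k), rigidMoment]
  simp
  ring

lemma factorial_mul_momentFunctional_choose (m : ℕ) :
    (m.factorial : ℝ) * momentFunctional ℝ (alphaPoly ℝ * Ring.choose (-betaPoly ℝ) m) =
      -∑ j ∈ Finset.range (m + 1), (-1) ^ j * shiftedEsymm (1 / 24) m j * rigidMoment (m - j) := by
  have h1 := prod_range_sub_natCast (-betaPoly ℝ) m
  have h2 : ∏ i ∈ Finset.range m, (-betaPoly ℝ - (i : Polynomial ℝ)) =
      ∏ i ∈ Finset.range m, (-(Polynomial.C (1 / 24) * Polynomial.X ^ 2) -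
        algebraMap ℝ (Polynomial ℝ) (i - 1 / 24)) := by
    refine Finset.prod_congr rfl fun i _ => ?_
    rw [betaPoly, Polynomial.algebraMap_apply, map_sub, map_sub]
    simp only [Algebra.algebraMap_self, RingHom.id_apply, map_natCast]
    ring
  rw [h2, prod_range_sub_eq_sum_shiftedEsymm] at h1
  rw [← smul_eq_mul, ← map_smul, Polynomial.smul_eq_C_mul, map_natCast, mul_left_comm, h1,
    Finset.mul_sum, map_sum, ← Finset.sum_neg_distrib]
  refine Finset.sum_congr rfl fun j _ => ?_
  rw [mul_left_comm, Polynomial.algebraMap_apply, momentFunctional_C_mul,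
    momentFunctional_alphaPoly_mul]
  simp

lemma factorial_mul_coeff_sum_prod (N m : ℕ) (h : m < N) :
    (m.factorial : ℝ) * coeff m (∑ n ∈ Finset.range (N + 1), ∏ i ∈ Finset.range n,
        (1 - PowerSeries.binomialSeries ℝ (-1 : ℝ) ^ (i + 1))) =
      ∑ j ∈ Finset.range (m + 1), (-1) ^ j * shiftedEsymm (1 / 24) m j * rigidMoment (m - j) := by
  have h1 := X_pow_dvd_iff.1 (X_pow_dvd_sum_prod_add_seriesMoment N) m h
  rw [map_add, coeff_seriesMoment, coeff_C_mul, binomialSeries_coeff, smul_eq_mul, mul_one] at h1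
  rw [eq_neg_of_add_eq_zero_left h1, mul_neg, factorial_mul_momentFunctional_choose, neg_neg]

end ZagierCoefficients

section Asymptotics

open Filter Topology

/-- The Dirichlet series `∑ (cos (π n / 6) - cos (5 π n / 6)) / n ^ (2 k + 2)`. -/
noncomputable def cosSum (k : ℕ) : ℝ :=
  ∑' n : ℕ, 1 / (n : ℝ) ^ (2 * (k + 1)) *
    (Real.cos (2 * Real.pi * n * (1 / 12)) - Real.cos (2 * Real.pi * n * (5 / 12)))

lemma hasSum_cosSum (k : ℕ) :
    HasSum (fun n : ℕ => 1 / (n : ℝ) ^ (2 * (k + 1)) *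
      (Real.cos (2 * Real.pi * n * (1 / 12)) - Real.cos (2 * Real.pi * n * (5 / 12))))
      ((-1) ^ k * (2 * Real.pi) ^ (2 * (k + 1)) / 2 / (2 * (k + 1)).factorial *
        (((Polynomial.bernoulli (2 * (k + 1))).eval (1 / 12) -
          (Polynomial.bernoulli (2 * (k + 1))).eval (5 / 12) : ℚ) : ℝ)) := by
  have h (q : ℚ) (hq : (q : ℝ) ∈ Set.Icc 0 1) :=
    hasSum_one_div_nat_pow_mul_cos (Nat.succ_ne_zero k) hq
  have h1 := h (1 / 12) (by norm_num)
  have h5 := h (5 / 12) (by norm_num)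
  have e (q : ℚ) : Polynomial.eval (q : ℝ) (Polynomial.map (algebraMap ℚ ℝ)
      (Polynomial.bernoulli (2 * (k + 1)))) = ((Polynomial.bernoulli (2 * (k + 1))).eval q : ℚ) := by
    rw [Polynomial.eval_map, ← eq_ratCast (algebraMap ℚ ℝ) q, Polynomial.eval₂_at_apply]
    rfl
  rw [Nat.succ_eq_add_one, e] at h1 h5
  convert! h1.sub h5 using 1
  · funext n; push_cast; ring
  · push_cast; ring

lemma rigidMoment_eq (k : ℕ) :
    rigidMoment k =
      6 ^ k * 24 * (2 * k + 1).factorial / (2 * Real.pi) ^ (2 * k + 2) * cosSum k := by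
  rw [rigidMoment, cosSum, (hasSum_cosSum k).tsum_eq, twelveMoment_odd,
    show 2 * (k + 1) = 2 * k + 1 + 1 by ring, Nat.factorial_succ (2 * k + 1)]
  have hf : ((2 * k + 1).factorial : ℝ) ≠ 0 := by positivity
  generalize ((2 * k + 1).factorial) = F at hf ⊢
  have hπ := Real.pi_ne_zero
  have hk : (k : ℝ) + 1 ≠ 0 := by positivity
  push_cast
  rw [show (12 : ℝ) ^ (2 * k + 1) = 12 * (6 ^ k * 24 ^ k) by
    rw [pow_succ, pow_mul, ← mul_pow]; norm_num; ring, show (-1 / 24 : ℝ) ^ k = (-1) ^ k / 24 ^ k from div_pow _ _ _]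
  field_simp
  ring

lemma abs_cosSum_sub_le (k : ℕ) : |cosSum k - √3| ≤ 2 * (Real.pi ^ 2 / 6 - 1) / 4 ^ k := by
  have h := (hasSum_cosSum k).summable.hasSum
  rw [← cosSum] at h
  have h1 := (hasSum_nat_add_iff' 2).2 h
  have hz := (hasSum_nat_add_iff' 2).2 hasSum_zeta_two
  have hz2 := (hz.mul_left (2 / 4 ^ k))
  have c1 : Real.cos (2 * Real.pi * 1 * (1 / 12)) = √3 / 2 := by
    rw [← Real.cos_pi_div_six]; congr 1; ring
  have c5 : Real.cos (2 * Real.pi * 1 * (5 / 12)) = -(√3 / 2) := by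
    rw [← Real.cos_pi_div_six, ← Real.cos_pi_sub]; congr 1; ring
  have e1 : ∑ n ∈ Finset.range 2, 1 / (n : ℝ) ^ (2 * (k + 1)) *
      (Real.cos (2 * Real.pi * n * (1 / 12)) - Real.cos (2 * Real.pi * n * (5 / 12))) = √3 := by
    rw [Finset.sum_range_succ, Finset.sum_range_one, Nat.cast_one, c1, c5]
    simp
  have e2 : ∑ n ∈ Finset.range 2, 1 / (n : ℝ) ^ 2 = 1 := by
    rw [Finset.sum_range_succ, Finset.sum_range_one]; simp
  rw [e1] at h1
  rw [e2] at hz2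
  rw [← h1.tsum_eq, ← Real.norm_eq_abs, mul_div_right_comm]
  refine tsum_of_norm_bounded hz2 fun n => ?_
  have hn : (4 : ℝ) ^ k ≤ (((n + 2 : ℕ) : ℝ) ^ 2) ^ k := by
    gcongr
    push_cast
    nlinarith [(Nat.cast_nonneg n : (0 : ℝ) ≤ n)]
  have hc : ∀ x y : ℝ, |Real.cos x - Real.cos y| ≤ 2 := fun x y => by
    rw [abs_le]
    constructor <;> linarith [Real.neg_one_le_cos x, Real.cos_le_one x, Real.neg_one_le_cos y,
      Real.cos_le_one y]
  rw [Real.norm_eq_abs, abs_mul, abs_of_nonneg (by positivity), show 2 * (k + 1) = 2 * k + 2 by ring,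
    pow_add, pow_mul]
  have hp : (0 : ℝ) < ((n + 2 : ℕ) : ℝ) := by positivity
  calc _ ≤ 1 / ((((n + 2 : ℕ) : ℝ) ^ 2) ^ k * ((n + 2 : ℕ) : ℝ) ^ 2) * 2 := by
        gcongr; exact hc _ _
    _ ≤ 1 / (4 ^ k * ((n + 2 : ℕ) : ℝ) ^ 2) * 2 := by gcongr
    _ = _ := by field_simp

lemma cosSum_pos (k : ℕ) : 0 < cosSum k := by
  have h := (abs_le.1 (abs_cosSum_sub_le k)).1
  have h3 : (1.7 : ℝ) < √3 := Real.lt_sqrt_of_sq_lt (by norm_num)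
  have hπ : Real.pi < 3.15 := Real.pi_lt_d2
  have hπ2 : Real.pi ^ 2 < 3.15 ^ 2 := by gcongr
  have hπ3 : (3 : ℝ) ^ 2 < Real.pi ^ 2 := by gcongr; exact Real.pi_gt_three
  have h4 : 2 * (Real.pi ^ 2 / 6 - 1) / 4 ^ k ≤ 2 * (Real.pi ^ 2 / 6 - 1) :=
    div_le_self (by linarith) (one_le_pow₀ (by norm_num))
  norm_num at hπ2
  linarith

lemma tendsto_cosSum : Tendsto cosSum atTop (𝓝 (√3)) := by
  rw [tendsto_iff_norm_sub_tendsto_zero]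
  refine squeeze_zero (fun _ => norm_nonneg _) abs_cosSum_sub_le ?_
  have := (tendsto_pow_atTop_nhds_zero_of_lt_one (r := (1 / 4 : ℝ)) (by norm_num)
    (by norm_num)).const_mul (2 * (Real.pi ^ 2 / 6 - 1))
  rw [mul_zero] at this
  refine this.congr fun k => ?_
  rw [div_pow, one_pow]; ring

lemma rigidMoment_pos (k : ℕ) : 0 < rigidMoment k := by
  rw [rigidMoment_eq]
  have := cosSum_pos k
  have := Real.pi_pos
  positivity

lemma tendsto_rigidMoment_ratio :
    Tendsto (fun n : ℕ => ((n : ℝ) + 1) ^ 2 * rigidMoment n / rigidMoment (n + 1)) atTop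
      (𝓝 (Real.pi ^ 2 / 6)) := by
  have h1 : Tendsto (fun n : ℕ => cosSum n / cosSum (n + 1)) atTop (𝓝 1) := by
    have h := tendsto_cosSum.div ((tendsto_add_atTop_iff_nat 1).2 tendsto_cosSum) (by positivity)
    rwa [div_self (by positivity)] at h
  have h2 : Tendsto (fun n : ℕ => (Real.pi ^ 2 / 6) * (1 - 1 / (2 * (n : ℝ) + 3)) *
      (cosSum n / cosSum (n + 1))) atTop (𝓝 (Real.pi ^ 2 / 6 * (1 - 0) * 1)) := by
    refine ((tendsto_const_nhds.sub ?_).const_mul _).mul h1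
    refine tendsto_const_nhds.div_atTop ?_
    exact tendsto_atTop_add_const_right _ _ (tendsto_natCast_atTop_atTop.const_mul_atTop two_pos)
  rw [sub_zero, mul_one, mul_one] at h2
  refine h2.congr fun n => ?_
  have hp := Real.pi_ne_zero
  have hc := (cosSum_pos n).ne'
  have hc1 := (cosSum_pos (n + 1)).ne'
  have hf : ((2 * n + 1).factorial : ℝ) ≠ 0 := by positivity
  rw [rigidMoment_eq, rigidMoment_eq, show 2 * (n + 1) + 1 = 2 * n + 1 + 1 + 1 by ring,
    Nat.factorial_succ (2 * n + 1 + 1), Nat.factorial_succ (2 * n + 1)]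
  generalize ((2 * n + 1).factorial) = F at hf ⊢
  have h3 : (2 * (n : ℝ) + 3) ≠ 0 := by positivity
  have h4 : ((n : ℝ) + 1) ≠ 0 := by positivity
  push_cast
  rw [show 2 * (n + 1) + 2 = 2 * n + 2 + 2 by ring, pow_add (2 * Real.pi) (2 * n + 2) 2]
  have h5 : (2 * (n : ℝ) + 1 + 1 + 1) = 2 * n + 3 := by ring
  have h6 : (2 * (n : ℝ) + 1 + 1) = 2 * (n + 1) := by ring
  rw [h5, h6]
  field_simp
  ring

end Asymptotics

/-- The supports of Fishburn matrices: subsets of a triangle `{(i, j) | i < j ≤ K}` meeting each of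
the `K` rows and each of the `K` columns. -/
def IsFishburn (A : Finset (ℕ × ℕ)) : Prop :=
  ∃ K, (∀ p ∈ A, p.1 < p.2 ∧ p.2 ≤ K) ∧ (∀ i < K, ∃ j, (i, j) ∈ A) ∧
    ∀ j < K, ∃ i, (i, j + 1) ∈ A

/-- The subsets of the triangle `{(i, j) | i < j ≤ K}` that meet each of the `K` columns. -/
noncomputable def columnFull (K : ℕ) : Finset (Finset (ℕ × ℕ)) :=
  (Finset.range K ×ˢ Finset.range (K + 1)).powerset.filter fun A =>
    (∀ p ∈ A, p.1 < p.2 ∧ p.2 ≤ K) ∧ ∀ j < K, ∃ i, (i, j + 1) ∈ A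

lemma mem_columnFull {K : ℕ} {A : Finset (ℕ × ℕ)} :
    A ∈ columnFull K ↔ (∀ p ∈ A, p.1 < p.2 ∧ p.2 ≤ K) ∧ ∀ j < K, ∃ i, (i, j + 1) ∈ A := by
  rw [columnFull, Finset.mem_filter, and_iff_right_iff_imp, Finset.mem_powerset]
  intro h p hp
  have := h.1 p hp
  rw [Finset.mem_product, Finset.mem_range, Finset.mem_range]
  omega

lemma le_card_of_mem_columnFull {K : ℕ} {A : Finset (ℕ × ℕ)} (h : A ∈ columnFull K) :
    K ≤ A.card := by
  choose! f hf using (mem_columnFull.1 h).2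
  rw [← Finset.card_range K]
  refine Finset.card_le_card_of_injOn (fun j => (f j, j + 1)) (fun j hj => ?_) (fun i _ j _ h => ?_)
  · exact hf j (by simpa using hj)
  · simpa using congrArg Prod.snd h

lemma Finset.mem_image_prodMk_const {b j i : ℕ} {C : Finset ℕ} :
    (i, j) ∈ C.image (·, b) ↔ i ∈ C ∧ j = b := by
  rw [Finset.mem_image]
  constructor
  · rintro ⟨c, hc, h⟩
    rw [Prod.mk.injEq] at h
    exact ⟨h.1 ▸ hc, h.2.symm⟩
  · rintro ⟨h, rfl⟩
    exact ⟨i, h, rfl⟩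

lemma mem_topColumn {b i : ℕ} {A : Finset (ℕ × ℕ)} :
    i ∈ (A.filter (·.2 = b)).image Prod.fst ↔ (i, b) ∈ A := by
  rw [Finset.mem_image]
  constructor
  · rintro ⟨p, hp, rfl⟩
    rw [Finset.mem_filter] at hp
    obtain ⟨hp, rfl⟩ := hp
    exact hp
  · intro h
    exact ⟨_, Finset.mem_filter.2 ⟨h, rfl⟩, rfl⟩

section RowWeight

variable {R : Type*} [CommRing R]

/-- The generating polynomial of `columnFull K` by size, nonempty rows and empty rows. -/
noncomputable def columnFullSum (w x y : R) (K : ℕ) : R :=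
  ∑ A ∈ columnFull K, w ^ A.card * ∏ i ∈ Finset.range K, if ∃ j, (i, j) ∈ A then y else x

lemma columnFullSum_zero (w x y : R) : columnFullSum w x y 0 = 1 := by
  have : columnFull 0 = {∅} := by
    ext A
    rw [mem_columnFull, Finset.mem_singleton, Finset.eq_empty_iff_forall_notMem]
    constructor
    · intro h p hp
      have := h.1 p hp
      omega
    · intro h
      exact ⟨fun p hp => absurd hp (h p), by simp⟩
  simp [columnFullSum, this]

lemma sum_powerset_row_weight (w x y : R) {K : ℕ} {A : Finset (ℕ × ℕ)} (hA : A ∈ columnFull K) :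
    ∑ C ∈ (Finset.range (K + 1)).powerset, w ^ C.card * ∏ i ∈ Finset.range (K + 1),
      (if (∃ j, (i, j) ∈ A) ∨ i ∈ C then y else x) =
    (x + w * y) * ∏ i ∈ Finset.range K, if ∃ j, (i, j) ∈ A then (1 + w) * y else x + w * y := by
  have hK : ¬ ∃ j, (K, j) ∈ A := by
    rintro ⟨j, hj⟩
    have := (mem_columnFull.1 hA).1 _ hj
    dsimp only at this
    omega
  have h1 := Finset.prod_add (fun _ : ℕ => w * y) (fun i => if ∃ j, (i, j) ∈ A then y else x)
    (Finset.range (K + 1))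
  rw [Finset.prod_range_succ, if_neg hK, add_comm, mul_comm] at h1
  trans ∑ t ∈ (Finset.range (K + 1)).powerset,
    (∏ _i ∈ t, w * y) * ∏ i ∈ Finset.range (K + 1) \ t, if ∃ j, (i, j) ∈ A then y else x
  · refine Finset.sum_congr rfl fun C hC => ?_
    rw [Finset.mem_powerset] at hC
    rw [← Finset.prod_sdiff hC, Finset.prod_mul_distrib, Finset.prod_const, mul_assoc, mul_comm (∏ _i ∈ _, _)]
    congr 2
    · exact Finset.prod_congr rfl fun i hi => if_pos (Or.inr hi)
    · refine Finset.prod_congr rfl fun i hi => ?_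
      simp [(Finset.mem_sdiff.1 hi).2]
  · rw [← h1]
    congr 1
    refine Finset.prod_congr rfl fun i _ => ?_
    split_ifs <;> ring

lemma columnFullSum_succ_eq_sum (w x y : R) (K : ℕ) :
    columnFullSum w x y (K + 1) = ∑ A ∈ columnFull K, ∑ C ∈ (Finset.range (K + 1)).powerset.erase ∅,
      w ^ A.card * (w ^ C.card * ∏ i ∈ Finset.range (K + 1),
        (if (∃ j, (i, j) ∈ A) ∨ i ∈ C then y else x)) := by
  rw [← Finset.sum_product', columnFullSum]
  refine Finset.sum_bij' (fun A _ => (A.filter (·.2 ≤ K), (A.filter (·.2 = K + 1)).image Prod.fst))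
    (fun q _ => q.1 ∪ q.2.image (·, K + 1)) ?_ ?_ ?_ ?_ ?_
  · intro A hA
    rw [mem_columnFull] at hA
    rw [Finset.mem_product, mem_columnFull, Finset.mem_erase, Finset.mem_powerset]
    refine ⟨⟨?_, ?_⟩, ?_, ?_⟩
    · intro p hp
      rw [Finset.mem_filter] at hp
      exact ⟨(hA.1 p hp.1).1, hp.2⟩
    · intro j hj
      obtain ⟨i, hi⟩ := hA.2 j (by omega)
      exact ⟨i, Finset.mem_filter.2 ⟨hi, hj⟩⟩
    · obtain ⟨i, hi⟩ := hA.2 K (by omega)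
      exact Finset.ne_empty_of_mem (Finset.mem_image.2 ⟨_, Finset.mem_filter.2 ⟨hi, rfl⟩, rfl⟩)
    · intro i hi
      obtain ⟨p, hp, rfl⟩ := Finset.mem_image.1 hi
      rw [Finset.mem_filter] at hp
      have := hA.1 p hp.1
      rw [Finset.mem_range]; omega
  · rintro ⟨A, C⟩ hq
    rw [Finset.mem_product, mem_columnFull, Finset.mem_erase, Finset.mem_powerset] at hq
    obtain ⟨⟨h1, h2⟩, h3, h4⟩ := hq
    dsimp only at h1 h2 h3 h4
    rw [mem_columnFull]
    constructor
    · intro p hp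
      rcases Finset.mem_union.1 hp with hp | hp
      · have := h1 p hp; omega
      · obtain ⟨c, hc, rfl⟩ := Finset.mem_image.1 hp
        have := Finset.mem_range.1 (h4 hc)
        dsimp only; omega
    · intro j hj
      rcases Nat.lt_succ_iff_lt_or_eq.1 hj with hj | rfl
      · obtain ⟨i, hi⟩ := h2 j hj
        exact ⟨i, Finset.mem_union_left _ hi⟩
      · obtain ⟨c, hc⟩ := Finset.nonempty_iff_ne_empty.2 h3
        exact ⟨c, Finset.mem_union_right _ (Finset.mem_image_of_mem _ hc)⟩
  · intro A hA
    rw [mem_columnFull] at hA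
    ext ⟨i, j⟩
    simp only [Finset.mem_union, Finset.mem_filter, Finset.mem_image_prodMk_const, mem_topColumn]
    constructor
    · rintro (h | ⟨h, rfl⟩)
      · exact h.1
      · exact h
    · intro h
      have := hA.1 _ h
      dsimp only at this
      rcases Nat.lt_or_ge K j with hj | hj
      · obtain rfl : j = K + 1 := by omega
        exact Or.inr ⟨h, rfl⟩
      · exact Or.inl ⟨h, hj⟩
  · rintro ⟨A, C⟩ hq
    rw [Finset.mem_product, mem_columnFull, Finset.mem_erase, Finset.mem_powerset] at hq
    obtain ⟨⟨h1, h2⟩, h3, h4⟩ := hq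
    dsimp only at h1 h2 h3 h4
    refine Prod.ext ?_ ?_
    · ext ⟨i, j⟩
      simp only [Finset.mem_union, Finset.mem_filter, Finset.mem_image_prodMk_const]
      constructor
      · rintro ⟨h | ⟨_, rfl⟩, hj⟩
        · exact h
        · omega
      · exact fun h => ⟨Or.inl h, (h1 _ h).2⟩
    · ext i
      simp only [Finset.mem_union, Finset.mem_image_prodMk_const, mem_topColumn]
      constructor
      · rintro (h | h)
        · have := h1 _ h
          dsimp only at this; omega
        · exact h.1
      · exact fun h => Or.inr ⟨h, trivial⟩
  · intro A hA
    rw [mem_columnFull] at hA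
    have hrow : ∀ i, (∃ j, (i, j) ∈ A) ↔ (∃ j, (i, j) ∈ A.filter (·.2 ≤ K)) ∨
        i ∈ (A.filter (·.2 = K + 1)).image Prod.fst := by
      intro i
      rw [mem_topColumn]
      constructor
      · rintro ⟨j, h⟩
        have := hA.1 _ h
        dsimp only at this
        rcases Nat.lt_or_ge K j with hj | hj
        · obtain rfl : j = K + 1 := by omega
          exact Or.inr h
        · exact Or.inl ⟨j, Finset.mem_filter.2 ⟨h, hj⟩⟩
      · rintro (⟨j, h⟩ | h)
        · exact ⟨j, (Finset.mem_filter.1 h).1⟩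
        · exact ⟨_, h⟩
    have hcard : A.card = (A.filter (·.2 ≤ K)).card +
        ((A.filter (·.2 = K + 1)).image Prod.fst).card := by
      rw [Finset.card_image_of_injOn, ← Finset.card_filter_add_card_filter_not (·.2 ≤ K)]
      · congr 2
        refine Finset.filter_congr fun p hp => ?_
        have := hA.1 p hp
        omega
      · rintro ⟨i, j⟩ h ⟨i', j'⟩ h' he
        rw [Finset.mem_coe, Finset.mem_filter] at h h'
        exact Prod.ext he (h.2.trans h'.2.symm)
    rw [← mul_assoc, ← pow_add, ← hcard]
    simp only [hrow]

/-- The recursion for adding a last column and a last row to a triangle. -/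
lemma columnFullSum_succ (w x y : R) (K : ℕ) :
    columnFullSum w x y (K + 1) =
      (x + w * y) * columnFullSum w (x + w * y) ((1 + w) * y) K - x * columnFullSum w x y K := by
  rw [columnFullSum_succ_eq_sum, columnFullSum, columnFullSum, Finset.mul_sum, Finset.mul_sum,
    ← Finset.sum_sub_distrib]
  refine Finset.sum_congr rfl fun A hA => ?_
  have hK : ¬ ∃ j, (K, j) ∈ A := by
    rintro ⟨j, hj⟩
    have := (mem_columnFull.1 hA).1 _ hj
    dsimp only at this
    omega
  rw [← Finset.mul_sum, Finset.sum_erase_eq_sub (Finset.empty_mem_powerset _),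
    sum_powerset_row_weight w x y hA, Finset.prod_range_succ]
  simp only [Finset.card_empty, Finset.notMem_empty, or_false, if_neg hK]
  ring

end RowWeight

section FishburnSeries

open PowerSeries

lemma X_pow_dvd_columnFullSum {x y : ℝ⟦X⟧} (K : ℕ) :
    (X : ℝ⟦X⟧) ^ K ∣ columnFullSum X x y K :=
  Finset.dvd_sum fun _ hA => Dvd.dvd.mul_right (pow_dvd_pow _ (le_card_of_mem_columnFull hA)) _

lemma X_pow_dvd_prod_one_sub_pow {p : ℝ⟦X⟧} (hp : X ∣ 1 - p) (N : ℕ) :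
    (X : ℝ⟦X⟧) ^ N ∣ ∏ i ∈ Finset.range N, (1 - p ^ (i + 1)) := by
  rw [← Finset.card_range N, ← Finset.prod_const, Finset.card_range]
  refine Finset.prod_dvd_prod_of_dvd _ _ fun i _ => hp.trans ?_
  simpa using sub_dvd_pow_sub_pow 1 p (i + 1)

/-- The generating series of `columnFull` at `x = q ^ j - 1`, `y = q ^ j`, `q = 1 + X`. -/
lemma sum_columnFullSum_recursion (N j : ℕ) :
    (1 + X) ^ j * ∑ K ∈ Finset.range (N + 1),
        columnFullSum (X : ℝ⟦X⟧) ((1 + X) ^ j - 1) ((1 + X) ^ j) K =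
      1 + ((1 + X) ^ (j + 1) - 1) * ∑ K ∈ Finset.range N,
        columnFullSum (X : ℝ⟦X⟧) ((1 + X) ^ (j + 1) - 1) ((1 + X) ^ (j + 1)) K +
      ((1 + X) ^ j - 1) * columnFullSum (X : ℝ⟦X⟧) ((1 + X) ^ j - 1) ((1 + X) ^ j) N := by
  induction N with
  | zero => simp [columnFullSum_zero]
  | succ N ih =>
    rw [Finset.sum_range_succ, mul_add, ih, columnFullSum_succ, Finset.sum_range_succ]
    have h1 : ((1 + X : ℝ⟦X⟧) ^ j - 1 + X * (1 + X) ^ j) = (1 + X) ^ (j + 1) - 1 := by ring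
    have h2 : (1 + X : ℝ⟦X⟧) * (1 + X) ^ j = (1 + X) ^ (j + 1) := by ring
    rw [h1, h2]
    ring

lemma X_pow_dvd_columnFullSum_step {p : ℝ⟦X⟧} (hp : p * (1 + X) = 1) (N j : ℕ) :
    (X : ℝ⟦X⟧) ^ N ∣ (1 + X) ^ j * (∑ K ∈ Finset.range N,
        columnFullSum (X : ℝ⟦X⟧) ((1 + X) ^ j - 1) ((1 + X) ^ j) K) -
      (1 + (1 - p ^ (j + 1)) * ((1 + X) ^ (j + 1) * ∑ K ∈ Finset.range N,
        columnFullSum (X : ℝ⟦X⟧) ((1 + X) ^ (j + 1) - 1) ((1 + X) ^ (j + 1)) K)) := by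
  have h := sum_columnFullSum_recursion N j
  have h2 : (1 - p ^ (j + 1)) * (1 + X) ^ (j + 1) = (1 + X) ^ (j + 1) - 1 := by
    rw [sub_mul, ← mul_pow, hp, one_pow, one_mul]
  rw [Finset.sum_range_succ, mul_add] at h
  rw [← mul_assoc, h2]
  have : ∀ a b c d t : ℝ⟦X⟧, a * b + a * c = 1 + d + (a - 1) * c → a * b - (1 + d) = -c := by
    intro a b c d t h
    linear_combination h
  rw [this _ _ _ _ 0 h]
  exact (X_pow_dvd_columnFullSum N).neg_right

lemma X_pow_dvd_columnFullSum_iterate {p : ℝ⟦X⟧} (hp : p * (1 + X) = 1) (N m : ℕ) :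
    (X : ℝ⟦X⟧) ^ N ∣ (∑ K ∈ Finset.range N, columnFullSum (X : ℝ⟦X⟧) 0 1 K) -
      (∑ n ∈ Finset.range m, ∏ i ∈ Finset.range n, (1 - p ^ (i + 1)) +
        (∏ i ∈ Finset.range m, (1 - p ^ (i + 1))) * ((1 + X) ^ m * ∑ K ∈ Finset.range N,
          columnFullSum (X : ℝ⟦X⟧) ((1 + X) ^ m - 1) ((1 + X) ^ m) K)) := by
  induction m with
  | zero => simp
  | succ m ih =>
    have := ih.add ((X_pow_dvd_columnFullSum_step hp N m).mul_left
      (∏ i ∈ Finset.range m, (1 - p ^ (i + 1))))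
    convert this using 1
    rw [Finset.sum_range_succ, Finset.prod_range_succ]
    ring

lemma coeff_sum_columnFullSum {N m : ℕ} (h : m < N) :
    coeff m (∑ K ∈ Finset.range N, columnFullSum (X : ℝ⟦X⟧) 0 1 K) =
      coeff m (∑ n ∈ Finset.range N, ∏ i ∈ Finset.range n,
        (1 - PowerSeries.binomialSeries ℝ (-1 : ℝ) ^ (i + 1))) := by
  have hp : PowerSeries.binomialSeries ℝ (-1 : ℝ) * (1 + X) = 1 := by
    rw [← binomialSeries_one_add_X, ← PowerSeries.binomialSeries_add]
    simp
  have h1 := X_pow_dvd_columnFullSum_iterate hp N N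
  have h2 := (X_pow_dvd_prod_one_sub_pow
    (X_dvd_one_sub_binomialSeries (-1 : ℝ)) N).mul_right ((1 + X) ^ N * ∑ K ∈ Finset.range N,
          columnFullSum (X : ℝ⟦X⟧) ((1 + X) ^ N - 1) ((1 + X) ^ N) K)
  have h3 := X_pow_dvd_iff.1 (h1.add h2) m h
  rw [← sub_eq_zero, ← map_sub, ← h3]
  congr 1
  ring

/-- The Fishburn supports of size `n`. -/
noncomputable def fishburnSets (n : ℕ) : Finset (Finset (ℕ × ℕ)) :=
  (Finset.range n ×ˢ Finset.range (n + 1)).powerset.filter fun A => IsFishburn A ∧ A.card = n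

lemma mem_fishburnSets {n : ℕ} {A : Finset (ℕ × ℕ)} :
    A ∈ fishburnSets n ↔ IsFishburn A ∧ A.card = n := by
  rw [fishburnSets, Finset.mem_filter, and_iff_right_iff_imp, Finset.mem_powerset]
  rintro ⟨⟨K, h1, -, h2⟩, rfl⟩ p hp
  have := h1 p hp
  have := le_card_of_mem_columnFull (mem_columnFull.2 ⟨h1, h2⟩)
  rw [Finset.mem_product, Finset.mem_range, Finset.mem_range]
  omega

lemma coeff_columnFullSum_zero_one (K m : ℕ) :
    coeff m (columnFullSum (X : ℝ⟦X⟧) 0 1 K) =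
      (((columnFull K).filter fun A => (∀ i < K, ∃ j, (i, j) ∈ A) ∧ A.card = m).card : ℝ) := by
  rw [columnFullSum, map_sum, Finset.card_filter, Nat.cast_sum]
  refine Finset.sum_congr rfl fun A _ => ?_
  rw [Finset.prod_ite_zero, Finset.prod_const_one]
  simp only [Finset.mem_range]
  split_ifs with h1 h2 h2
  · simp [h2.2]
  · rw [mul_one, coeff_X_pow, if_neg fun h => h2 ⟨h1, h.symm⟩, Nat.cast_zero]
  · exact absurd h2.1 h1
  · simp

lemma IsFishburn.size_unique {A : Finset (ℕ × ℕ)} {K L : ℕ}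
    (h1 : ∀ p ∈ A, p.1 < p.2 ∧ p.2 ≤ K) (h2 : ∀ j < L, ∃ i, (i, j + 1) ∈ A) : L ≤ K := by
  by_contra! h
  obtain ⟨i, hi⟩ := h2 K h
  have := h1 _ hi
  dsimp only at this
  omega

lemma coeff_sum_columnFullSum_eq_card {N m : ℕ} (h : m < N) :
    coeff m (∑ K ∈ Finset.range N, columnFullSum (X : ℝ⟦X⟧) 0 1 K) =
      ((fishburnSets m).card : ℝ) := by
  rw [map_sum]
  simp only [coeff_columnFullSum_zero_one]
  rw [← Nat.cast_sum, ← Finset.card_biUnion]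
  · congr 2
    ext A
    rw [mem_fishburnSets, Finset.mem_biUnion]
    simp only [Finset.mem_filter, mem_columnFull, Finset.mem_range]
    constructor
    · rintro ⟨K, -, ⟨h1, h2⟩, h3, h4⟩
      exact ⟨⟨K, h1, h3, h2⟩, h4⟩
    · rintro ⟨⟨K, h1, h2, h3⟩, h4⟩
      have := le_card_of_mem_columnFull (mem_columnFull.2 ⟨h1, h3⟩)
      exact ⟨K, by omega, ⟨h1, h3⟩, h2, h4⟩
  · intro K _ L _ hKL
    refine Finset.disjoint_left.2 fun A hA hA' => hKL ?_
    rw [Finset.mem_filter, mem_columnFull] at hA hA'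
    exact le_antisymm (IsFishburn.size_unique hA'.1.1 hA.1.2)
      (IsFishburn.size_unique hA.1.1 hA'.1.2)

lemma tendsto_card_fishburnSets_ratio :
    Filter.Tendsto (fun n : ℕ => ((n : ℝ) + 1) * (fishburnSets n).card / (fishburnSets (n + 1)).card)
      Filter.atTop (nhds (Real.pi ^ 2 / 6)) := by
  refine tendsto_ratio_of_eq_sum_shiftedEsymm (b := 1 / 24) (by norm_num) (by norm_num)
    rigidMoment_pos tendsto_rigidMoment_ratio (r := fun n => ((fishburnSets n).card : ℝ)) fun m => ?_
  rw [← factorial_mul_coeff_sum_prod (m + 1) m (by omega),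
    ← coeff_sum_columnFullSum (by omega), coeff_sum_columnFullSum_eq_card (by omega)]

lemma card_fishburnSets_pos (n : ℕ) : 0 < (fishburnSets n).card := by
  refine Finset.card_pos.2 ⟨(Finset.range n).image fun i => (i, i + 1), mem_fishburnSets.2
    ⟨⟨n, ?_, ?_, ?_⟩, ?_⟩⟩
  · intro p hp
    obtain ⟨i, hi, rfl⟩ := Finset.mem_image.1 hp
    have := Finset.mem_range.1 hi
    dsimp only
    omega
  · exact fun i hi => ⟨i + 1, Finset.mem_image.2 ⟨i, Finset.mem_range.2 hi, rfl⟩⟩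
  · exact fun i hi => ⟨i, Finset.mem_image.2 ⟨i, Finset.mem_range.2 hi, rfl⟩⟩
  · rw [Finset.card_image_of_injective _ fun i j h => congrArg Prod.fst h, Finset.card_range]

end FishburnSeries

/-- The number of unordered pairs of equal elements (at distinct positions) of a multiset. -/
def Multiset.pairCount {α : Type*} [DecidableEq α] (m : Multiset α) : ℕ :=
  ∑ p ∈ m.toFinset, (m.count p).choose 2

lemma toFinset_val_add {α : Type*} [DecidableEq α] {A : Finset α} {s : Multiset α}
    (h : ∀ a ∈ s, a ∈ A) : (A.val + s).toFinset = A := by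
  rw [Multiset.toFinset_add, Finset.val_toFinset, Finset.union_eq_left]
  exact fun a ha => h a (Multiset.mem_toFinset.1 ha)

/-- The multisets with support `A` and `j` more elements than `A`. -/
noncomputable def multisetsOn {α : Type*} [DecidableEq α] (A : Finset α) (j : ℕ) : Finset (Multiset α) :=
  (Finset.univ : Finset (Sym A j)).image fun s => A.val + s.1.map Subtype.val

lemma mem_multisetsOn {α : Type*} [DecidableEq α] {A : Finset α} {j : ℕ} {m : Multiset α} :
    m ∈ multisetsOn A j ↔ m.toFinset = A ∧ m.card = A.card + j := by
  rw [multisetsOn, Finset.mem_image]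
  constructor
  · rintro ⟨s, -, rfl⟩
    refine ⟨toFinset_val_add fun a ha => ?_, ?_⟩
    · obtain ⟨b, -, rfl⟩ := Multiset.mem_map.1 ha
      exact b.2
    · rw [Multiset.card_add, Multiset.card_map, s.2, Finset.card_val]
  · rintro ⟨rfl, hm⟩
    have hle : m.toFinset.val ≤ m := by
      rw [Multiset.toFinset_val]; exact Multiset.dedup_le m
    obtain ⟨t, ht⟩ := Multiset.le_iff_exists_add.1 hle
    have hmem : ∀ a ∈ t, a ∈ m.toFinset := fun a ha => by
      rw [Multiset.mem_toFinset, ht]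
      exact Multiset.mem_add.2 (Or.inr ha)
    obtain ⟨s, hs⟩ : ∃ s : Multiset m.toFinset, s.map Subtype.val = t := by
      refine ⟨t.attach.map fun a => ⟨a.1, hmem a.1 a.2⟩, ?_⟩
      rw [Multiset.map_map]
      exact Multiset.attach_map_val t
    refine ⟨⟨s, ?_⟩, Finset.mem_univ _, ?_⟩
    · have h1 := congrArg Multiset.card hs
      have h2 := congrArg Multiset.card ht
      rw [Multiset.card_add, Finset.card_val] at h2
      rw [Multiset.card_map] at h1
      omega
    · dsimp only
      rw [hs, ← ht]

lemma card_multisetsOn {α : Type*} [DecidableEq α] (A : Finset α) (j : ℕ) :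
    (multisetsOn A j).card = A.card.multichoose j := by
  rw [multisetsOn, Finset.card_image_of_injective, Finset.card_univ, Sym.card_sym_eq_multichoose,
    Fintype.card_coe]
  intro s t h
  exact Subtype.ext (Multiset.map_injective Subtype.val_injective (add_left_cancel h))

/-- The multisets of size `n` whose support is Fishburn. -/
noncomputable def fishburnMultisets (n : ℕ) : Finset (Multiset (ℕ × ℕ)) :=
  (Finset.range (n + 1)).biUnion fun j => (fishburnSets (n - j)).biUnion fun A => multisetsOn A j

lemma mem_fishburnMultisets {n : ℕ} {m : Multiset (ℕ × ℕ)} :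
    m ∈ fishburnMultisets n ↔ IsFishburn m.toFinset ∧ m.card = n := by
  simp only [fishburnMultisets, Finset.mem_biUnion, mem_multisetsOn, mem_fishburnSets,
    Finset.mem_range]
  constructor
  · rintro ⟨j, hj, A, ⟨h1, h2⟩, rfl, h3⟩
    exact ⟨h1, by omega⟩
  · rintro ⟨h1, h2⟩
    have := Multiset.toFinset_card_le m
    exact ⟨n - m.toFinset.card, by omega, _, ⟨h1, by omega⟩, rfl, by omega⟩

lemma card_fishburnMultisets (n : ℕ) :
    (fishburnMultisets n).card =
      ∑ j ∈ Finset.range (n + 1), (fishburnSets (n - j)).card * (n - 1).choose j := by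
  rw [fishburnMultisets, Finset.card_biUnion]
  · refine Finset.sum_congr rfl fun j hj => ?_
    rw [Finset.card_biUnion]
    · rw [Finset.sum_const_nat]
      intro A hA
      have := Finset.mem_range.1 hj
      rw [card_multisetsOn, (mem_fishburnSets.1 hA).2, Nat.multichoose_eq]
      congr 1
      omega
    · intro A _ B _ hAB
      refine Finset.disjoint_left.2 fun m hA hB => hAB ?_
      rw [← (mem_multisetsOn.1 hA).1, (mem_multisetsOn.1 hB).1]
  · intro i hi j hj hij
    rw [Finset.mem_coe, Finset.mem_range] at hi hj
    refine Finset.disjoint_left.2 fun m h h' => hij ?_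
    simp only [Finset.mem_biUnion, mem_multisetsOn, mem_fishburnSets] at h h'
    obtain ⟨A, h1, h2, h3⟩ := h
    obtain ⟨B, h1', h2', h3'⟩ := h'
    obtain rfl : A = B := h2.symm.trans h2'
    omega

lemma pairCount_val_add {α : Type*} [DecidableEq α] {A B : Finset α} (h : B ⊆ A) :
    (A.val + B.val).pairCount = B.card := by
  rw [Multiset.pairCount, toFinset_val_add fun a ha => h ha, Finset.card_eq_sum_ones,
    ← Finset.sum_subset h (fun a ha ha' => ?_)]
  · refine Finset.sum_congr rfl fun a ha => ?_
    rw [Multiset.count_add, Multiset.count_eq_one_of_mem A.nodup (h ha),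
      Multiset.count_eq_one_of_mem B.nodup ha]
    rfl
  · rw [Multiset.count_add, Multiset.count_eq_one_of_mem A.nodup ha,
      Multiset.count_eq_zero_of_notMem ha']
    rfl

lemma card_fishburnSets_mul_choose_le {n k : ℕ} (h : k ≤ n) :
    (fishburnSets (n - k)).card * (n - k).choose k ≤
      ((fishburnMultisets n).filter fun m => m.pairCount = k).card := by
  have : (fishburnSets (n - k)).card * (n - k).choose k =
      ((fishburnSets (n - k)).sigma fun A => A.powersetCard k).card := by
    rw [Finset.card_sigma, Finset.sum_const_nat]
    intro A hA
    rw [Finset.card_powersetCard, (mem_fishburnSets.1 hA).2]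
  rw [this]
  refine Finset.card_le_card_of_injOn (fun q => q.1.val + q.2.val) ?_ ?_
  · rintro ⟨A, B⟩ hq
    rw [Finset.mem_coe, Finset.mem_sigma, mem_fishburnSets, Finset.mem_powersetCard] at hq
    obtain ⟨⟨h1, h2⟩, h3, h4⟩ := hq
    dsimp only at h1 h2 h3 h4
    dsimp only
    rw [Finset.mem_coe, Finset.mem_filter, mem_fishburnMultisets, pairCount_val_add h3,
      toFinset_val_add fun a ha => h3 ha]
    refine ⟨⟨h1, ?_⟩, h4⟩
    rw [Multiset.card_add, Finset.card_val, Finset.card_val]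
    omega
  · rintro ⟨A, B⟩ hq ⟨A', B'⟩ hq' he
    rw [Finset.mem_coe, Finset.mem_sigma, Finset.mem_powersetCard] at hq hq'
    dsimp only at hq hq' he
    have hA := congrArg Multiset.toFinset he
    rw [toFinset_val_add fun a ha => hq.2.1 ha, toFinset_val_add fun a ha => hq'.2.1 ha] at hA
    subst hA
    rw [Finset.val_inj.1 (add_left_cancel he)]

lemma sum_card_pairCount_le (n : ℕ) :
    ∑ k ∈ Finset.range (n + 1), ((fishburnMultisets n).filter fun m => m.pairCount = k).card ≤
      (fishburnMultisets n).card := by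
  rw [← Finset.card_biUnion]
  · exact Finset.card_le_card (Finset.biUnion_subset.2 fun k _ => Finset.filter_subset _ _)
  · intro k _ l _ hkl
    refine Finset.disjoint_left.2 fun m h h' => hkl ?_
    rw [← (Finset.mem_filter.1 h).2, (Finset.mem_filter.1 h').2]

lemma tendsto_card_pairCount_div (k : ℕ) :
    Filter.Tendsto (fun n => (((fishburnMultisets n).filter fun m => m.pairCount = k).card : ℝ) /
      ((fishburnMultisets n).card : ℝ)) Filter.atTop
      (nhds (Real.exp (-(Real.pi ^ 2 / 6)) * (Real.pi ^ 2 / 6) ^ k / k.factorial)) := by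
  have hlow : ∀ n k, k ≤ n → (fishburnSets (n - k)).card * (n - k).choose k ≤
      ((fishburnMultisets n).filter fun m => m.pairCount = k).card :=
    fun _ _ => card_fishburnSets_mul_choose_le
  exact tendsto_div_exp_neg_mul_pow_of_ratio tendsto_card_fishburnSets_ratio card_fishburnSets_pos
    card_fishburnMultisets hlow sum_card_pairCount_le k

/-- `f` represents `r` by intervals with endpoints in `{0, …, K}`, every point of `{0, …, K - 1}`
being a left endpoint and every point of `{1, …, K}` a right endpoint. -/
def IsIntervalRep {α : Type*} (r : α → α → Prop) (K : ℕ) (f : α → ℕ × ℕ) : Prop :=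
  (∀ x y, r x y ↔ (f x).2 ≤ (f y).1) ∧ (∀ x, (f x).1 < (f x).2 ∧ (f x).2 ≤ K) ∧
    (∀ i < K, ∃ x, (f x).1 = i) ∧ ∀ j < K, ∃ x, (f x).2 = j + 1

section

variable {α : Type*} [Fintype α] (r : α → α → Prop)

/-- The strict down-set of `x`. -/
noncomputable def strictDown (x : α) : Finset α :=
  Finset.univ.filter fun y => r y x

/-- All strict down-sets. -/
noncomputable def strictDowns : Finset (Finset α) :=
  Finset.univ.image (strictDown r)

/-- The canonical interval of `x`. -/
noncomputable def canonicalInterval (x : α) : ℕ × ℕ :=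
  (((strictDowns r).filter (· ⊂ strictDown r x)).card, ((strictDowns r).filter (x ∉ ·)).card)

variable {r}

lemma mem_strictDown {x y : α} : y ∈ strictDown r x ↔ r y x := by
  simp [strictDown]

lemma mem_strictDowns {D : Finset α} : D ∈ strictDowns r ↔ ∃ x, strictDown r x = D := by
  simp [strictDowns]

lemma IsIntervalRep.eq_canonicalInterval {K : ℕ} {f : α → ℕ × ℕ} (h : IsIntervalRep r K f) :
    f = canonicalInterval r := by
  obtain ⟨h1, h2, h3, h4⟩ := h
  funext x
  have : Nonempty α := ⟨x⟩
  choose! s hs using h3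
  have hsub : ∀ y z, strictDown r y ⊆ strictDown r z ↔ (f y).1 ≤ (f z).1 := by
    intro y z
    constructor
    · intro h
      by_contra! hlt
      have := h2 y
      obtain ⟨x, hx⟩ := h4 ((f y).1 - 1) (by omega)
      have := h (mem_strictDown.2 ((h1 x y).2 (by omega)))
      rw [mem_strictDown, h1] at this
      omega
    · intro h x hx
      rw [mem_strictDown, h1] at hx ⊢
      exact hx.trans h
  have hcard : ∀ m ≤ K, ((Finset.range m).image fun i => strictDown r (s i)).card = m := by
    intro m hm
    rw [Finset.card_image_of_injOn, Finset.card_range]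
    intro i hi j hj hij
    rw [Finset.mem_coe, Finset.mem_range] at hi hj
    rw [← hs i (by omega), ← hs j (by omega)]
    exact le_antisymm ((hsub _ _).1 hij.subset) ((hsub _ _).1 hij.superset)
  have heq : ∀ z, strictDown r (s (f z).1) = strictDown r z := by
    intro z
    have := hs (f z).1 (by have := h2 z; omega)
    exact Finset.Subset.antisymm ((hsub _ _).2 this.le) ((hsub _ _).2 this.ge)
  have hx := h2 x
  refine Prod.ext ?_ ?_
  · rw [canonicalInterval, ← hcard (f x).1 (by omega)]
    congr 1
    ext D
    rw [Finset.mem_image, Finset.mem_filter, mem_strictDowns]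
    constructor
    · rintro ⟨i, hi, rfl⟩
      rw [Finset.mem_range] at hi
      refine ⟨⟨_, rfl⟩, Finset.ssubset_def.2 ?_⟩
      rw [hsub, hsub, hs i (by omega)]
      omega
    · rintro ⟨⟨z, rfl⟩, hz⟩
      rw [Finset.ssubset_def, hsub, hsub] at hz
      exact ⟨(f z).1, Finset.mem_range.2 (by omega), heq z⟩
  · rw [canonicalInterval, ← hcard (f x).2 (by omega)]
    congr 1
    ext D
    rw [Finset.mem_image, Finset.mem_filter, mem_strictDowns]
    constructor
    · rintro ⟨i, hi, rfl⟩
      rw [Finset.mem_range] at hi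
      refine ⟨⟨_, rfl⟩, ?_⟩
      rw [mem_strictDown, h1, hs i (by omega)]
      omega
    · rintro ⟨⟨z, rfl⟩, hz⟩
      rw [mem_strictDown, h1] at hz
      exact ⟨(f z).1, Finset.mem_range.2 (by omega), heq z⟩

lemma isIntervalRep_canonicalInterval (hirr : ∀ a, ¬ r a a)
    (h22 : ∀ a b c d, r a b → r c d → r a d ∨ r c b) :
    IsIntervalRep r (strictDowns r).card (canonicalInterval r) := by
  have hchain : ∀ D ∈ strictDowns r, ∀ E ∈ strictDowns r, D ⊂ E ∨ E ⊆ D := by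
    intro D hD E hE
    obtain ⟨x, rfl⟩ := mem_strictDowns.1 hD
    obtain ⟨y, rfl⟩ := mem_strictDowns.1 hE
    by_contra! h
    obtain ⟨a, ha, ha'⟩ := Finset.not_subset.1 h.2
    have h3 : ¬ strictDown r x ⊆ strictDown r y := fun h4 => h.1 (Finset.ssubset_def.2 ⟨h4, h.2⟩)
    obtain ⟨b, hb, hb'⟩ := Finset.not_subset.1 h3
    rw [mem_strictDown] at ha ha' hb hb'
    rcases h22 a y b x ha hb with h | h <;> contradiction
  have hmem : ∀ x, strictDown r x ∈ strictDowns r := fun x => mem_strictDowns.2 ⟨x, rfl⟩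
  have hrep : ∀ x y, r x y ↔ (canonicalInterval r x).2 ≤ (canonicalInterval r y).1 := by
    intro x y
    constructor
    · intro h
      refine Finset.card_le_card fun D hD => ?_
      rw [Finset.mem_filter] at hD ⊢
      refine ⟨hD.1, (hchain D hD.1 _ (hmem y)).resolve_right fun h' => hD.2 ?_⟩
      exact h' (mem_strictDown.2 h)
    · contrapose!
      intro h
      refine Finset.card_lt_card (Finset.ssubset_iff_of_subset ?_ |>.2
        ⟨strictDown r y, ?_, ?_⟩)
      · intro D hD
        rw [Finset.mem_filter] at hD ⊢
        exact ⟨hD.1, fun hx => h (mem_strictDown.1 (hD.2.subset hx))⟩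
      · exact Finset.mem_filter.2 ⟨hmem y, fun hx => h (mem_strictDown.1 hx)⟩
      · simp
  have hlt : ∀ x, (canonicalInterval r x).1 < (canonicalInterval r x).2 := fun x =>
    not_le.1 fun h => hirr x ((hrep x x).2 h)
  have hleft : ∀ i < (strictDowns r).card, ∃ x, (canonicalInterval r x).1 = i := by
    intro i hi
    have hmono : ∀ D ∈ strictDowns r, ∀ E ∈ strictDowns r, D ⊂ E →
        ((strictDowns r).filter (· ⊂ D)).card < ((strictDowns r).filter (· ⊂ E)).card := by
      intro D hD E hE hDE
      refine Finset.card_lt_card (Finset.ssubset_iff_of_subset ?_ |>.2 ⟨D, ?_, ?_⟩)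
      · intro F hF
        rw [Finset.mem_filter] at hF ⊢
        exact ⟨hF.1, hF.2.trans hDE⟩
      · exact Finset.mem_filter.2 ⟨hD, hDE⟩
      · simp
    have hsurj := Finset.surjOn_of_injOn_of_card_le (s := strictDowns r)
      (t := Finset.range (strictDowns r).card)
      (fun D => ((strictDowns r).filter (· ⊂ D)).card) ?_ ?_ (by simp)
    · obtain ⟨D, hD, h⟩ := hsurj (Finset.mem_coe.2 (Finset.mem_range.2 hi))
      obtain ⟨x, rfl⟩ := mem_strictDowns.1 hD
      exact ⟨x, h⟩
    · intro D hD
      refine Finset.mem_coe.2 (Finset.mem_range.2 (Finset.card_lt_card ?_))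
      exact Finset.filter_ssubset.2 ⟨D, hD, by simp⟩
    · intro D hD E hE h
      dsimp only at h
      rcases hchain D hD E hE with h' | h'
      · exact absurd h (hmono D hD E hE h').ne
      · rcases hchain E hE D hD with h'' | h''
        · exact absurd h (hmono E hE D hD h'').ne'
        · exact Finset.Subset.antisymm h'' h'
  refine ⟨hrep, fun x => ⟨hlt x, Finset.card_le_card (Finset.filter_subset _ _)⟩, hleft, ?_⟩
  intro j hj
  rcases Nat.lt_or_ge (j + 1) (strictDowns r).card with hj' | hj'
  · obtain ⟨y, hy⟩ := hleft j hj
    obtain ⟨z, hz⟩ := hleft (j + 1) hj'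
    have hne : ¬ strictDown r z ⊆ strictDown r y := by
      intro h
      have : (canonicalInterval r z).1 ≤ (canonicalInterval r y).1 := by
        refine Finset.card_le_card fun D hD => ?_
        rw [Finset.mem_filter] at hD ⊢
        exact ⟨hD.1, hD.2.trans_subset h⟩
      omega
    obtain ⟨x, hx, hx'⟩ := Finset.not_subset.1 hne
    rw [mem_strictDown, hrep] at hx hx'
    exact ⟨x, by omega⟩
  · obtain ⟨y, -⟩ := hleft j hj
    obtain ⟨x, -, hx⟩ := Finset.exists_max_image Finset.univ (fun x => (canonicalInterval r x).2)
      ⟨y, Finset.mem_univ y⟩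
    refine ⟨x, ?_⟩
    have : (canonicalInterval r x).2 = (strictDowns r).card := by
      refine congrArg Finset.card (Finset.filter_true_of_mem fun D hD hxD => ?_)
      obtain ⟨z, rfl⟩ := mem_strictDowns.1 hD
      rw [mem_strictDown, hrep] at hxD
      have := hlt z
      have := hx z (Finset.mem_univ z)
      omega
    omega

lemma canonicalInterval_eq_iff (hirr : ∀ a, ¬ r a a)
    (h22 : ∀ a b c d, r a b → r c d → r a d ∨ r c b) {x y : α} :
    canonicalInterval r x = canonicalInterval r y ↔
      (∀ z, r z x ↔ r z y) ∧ ∀ z, r x z ↔ r y z := by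
  have hrep := (isIntervalRep_canonicalInterval hirr h22).1
  constructor
  · intro h
    simp [hrep, h]
  · rintro ⟨h1, h2⟩
    have hdown : strictDown r x = strictDown r y := by
      ext z
      simp only [mem_strictDown, h1]
    refine Prod.ext ?_ ?_
    · rw [canonicalInterval, canonicalInterval, hdown]
    · refine congrArg Finset.card (Finset.filter_congr fun D hD => ?_)
      obtain ⟨z, rfl⟩ := mem_strictDowns.1 hD
      rw [mem_strictDown, mem_strictDown, h2]

end

lemma exists_perm_of_map_eq {α β : Type*} [Fintype α] {f g : α → β}
    (h : Finset.univ.val.map f = Finset.univ.val.map g) : ∃ e : Equiv.Perm α, g ∘ e = f := by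
  have hcard : ∀ c, Nonempty ({a // f a = c} ≃ {a // g a = c}) := by
    intro c
    have := congrArg (Multiset.count c) h
    rw [Multiset.count_map, Multiset.count_map] at this
    refine ⟨Fintype.equivOfCardEq ?_⟩
    rw [Fintype.card_subtype, Fintype.card_subtype]
    simp only [eq_comm (a := c)] at this
    exact this
  exact ⟨Equiv.ofFiberEquiv fun c => Classical.choice (hcard c),
    funext fun a => Equiv.ofFiberEquiv_map _ a⟩

section Profile

variable {n : ℕ}

/-- The multiset of canonical intervals of an interval order. -/
noncomputable def profile (P : IntervalOrderRel n) : Multiset (ℕ × ℕ) :=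
  Finset.univ.val.map (canonicalInterval P.1)

lemma IntervalOrderRel.irrefl (P : IntervalOrderRel n) (a : Fin n) : ¬ P.1 a a :=
  P.2.1.irrefl a

lemma profile_eq_iff {P Q : IntervalOrderRel n} :
    IntervalOrderIso P Q ↔ profile P = profile Q := by
  have hP := isIntervalRep_canonicalInterval P.irrefl P.2.2
  have hQ := isIntervalRep_canonicalInterval Q.irrefl Q.2.2
  constructor
  · rintro ⟨e, he⟩
    have : IsIntervalRep P.1 (strictDowns Q.1).card (canonicalInterval Q.1 ∘ e) := by
      refine ⟨fun x y => (he x y).trans (hQ.1 _ _), fun x => hQ.2.1 _, fun i hi => ?_,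
        fun j hj => ?_⟩
      · obtain ⟨x, hx⟩ := hQ.2.2.1 i hi
        exact ⟨e.symm x, by simpa using hx⟩
      · obtain ⟨x, hx⟩ := hQ.2.2.2 j hj
        exact ⟨e.symm x, by simpa using hx⟩
    rw [profile, profile, ← this.eq_canonicalInterval, ← Multiset.map_map,
      Multiset.map_univ_val_equiv]
  · intro h
    obtain ⟨e, he⟩ := exists_perm_of_map_eq h
    exact ⟨e, fun a b => by rw [hP.1, hQ.1, ← he]; rfl⟩

lemma profile_mem_fishburnMultisets (P : IntervalOrderRel n) :
    profile P ∈ fishburnMultisets n := by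
  obtain ⟨-, h2, h3, h4⟩ := isIntervalRep_canonicalInterval P.irrefl P.2.2
  have hmem : ∀ p, p ∈ (profile P).toFinset ↔ ∃ x, canonicalInterval P.1 x = p := by
    simp [profile]
  refine mem_fishburnMultisets.2 ⟨⟨(strictDowns P.1).card, fun p hp => ?_, fun i hi => ?_,
    fun j hj => ?_⟩, by simp [profile]⟩
  · obtain ⟨x, rfl⟩ := (hmem p).1 hp
    exact h2 x
  · obtain ⟨x, hx⟩ := h3 i hi
    exact ⟨_, (hmem _).2 ⟨x, Prod.ext hx rfl⟩⟩
  · obtain ⟨x, hx⟩ := h4 j hj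
    exact ⟨_, (hmem _).2 ⟨x, Prod.ext rfl hx⟩⟩

lemma exists_profile_eq {m : Multiset (ℕ × ℕ)} (hm : m ∈ fishburnMultisets n) :
    ∃ P : IntervalOrderRel n, profile P = m := by
  obtain ⟨⟨K, h1, h2, h3⟩, rfl⟩ := mem_fishburnMultisets.1 hm
  obtain ⟨f, hf⟩ : ∃ f : Fin m.card → ℕ × ℕ, Finset.univ.val.map f = m := by
    induction m using Quotient.inductionOn with
    | h l => exact ⟨l.get, (Fin.univ_val_map _).trans (congrArg _ (List.ofFn_get l))⟩
  have hmem : ∀ p, p ∈ m.toFinset ↔ ∃ x, f x = p := by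
    intro p
    rw [Multiset.mem_toFinset]
    conv_lhs => rw [← hf]
    simp
  have hlt : ∀ x, (f x).1 < (f x).2 ∧ (f x).2 ≤ K := fun x => h1 _ ((hmem _).2 ⟨x, rfl⟩)
  let P : IntervalOrderRel m.card := ⟨fun x y => (f x).2 ≤ (f y).1,
    { irrefl := fun a => not_le.2 (hlt a).1
      trans := fun a b c hab hbc => hab.trans ((hlt b).1.le.trans hbc) },
    fun a b c d hab hcd => by dsimp only at *; omega⟩
  have hrep : IsIntervalRep P.1 K f := by
    refine ⟨fun _ _ => Iff.rfl, hlt, fun i hi => ?_, fun j hj => ?_⟩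
    · obtain ⟨j, hj⟩ := h2 i hi
      obtain ⟨x, hx⟩ := (hmem _).1 hj
      exact ⟨x, congrArg Prod.fst hx⟩
    · obtain ⟨i, hi⟩ := h3 j hj
      obtain ⟨x, hx⟩ := (hmem _).1 hi
      exact ⟨x, congrArg Prod.snd hx⟩
  exact ⟨P, by rw [profile, ← hrep.eq_canonicalInterval, hf]⟩

lemma dupPairCount_eq_pairCount (P : IntervalOrderRel n) :
    dupPairCount P = (profile P).pairCount := by
  have hdup : ∀ x y, DupHoldings P x y ↔
      x ≠ y ∧ canonicalInterval P.1 x = canonicalInterval P.1 y := fun x y => by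
    rw [DupHoldings, canonicalInterval_eq_iff P.irrefl P.2.2]
  have hcount : ∀ p, (profile P).count p =
      (Finset.univ.filter fun x => canonicalInterval P.1 x = p).card := fun p => by
    rw [profile, Multiset.count_map]
    simp only [eq_comm (a := p)]
    rfl
  rw [Multiset.pairCount]
  simp only [hcount, ← Finset.card_powersetCard]
  rw [← Finset.card_biUnion, dupPairCount, Nat.card_eq_fintype_card, Fintype.card_subtype]
  · congr 1
    ext s
    simp only [Finset.mem_filter, Finset.mem_univ, true_and, Finset.mem_biUnion,
      Finset.mem_powersetCard, hdup]
    constructor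
    · rintro ⟨x, y, ⟨hxy, h⟩, rfl⟩
      refine ⟨canonicalInterval P.1 x, by simp [profile], ?_, Finset.card_pair hxy⟩
      intro z hz
      rw [Finset.mem_filter]
      refine ⟨Finset.mem_univ z, ?_⟩
      rcases Finset.mem_insert.1 hz with rfl | hz
      · rfl
      · rw [Finset.mem_singleton.1 hz, h]
    · rintro ⟨p, -, hs, h2⟩
      obtain ⟨x, y, hxy, rfl⟩ := Finset.card_eq_two.1 h2
      have hx := (Finset.mem_filter.1 (hs (Finset.mem_insert_self x {y}))).2
      have hy := (Finset.mem_filter.1 (hs (Finset.mem_insert_of_mem (Finset.mem_singleton_self y)))).2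
      exact ⟨x, y, ⟨hxy, hx.trans hy.symm⟩, rfl⟩
  · intro p _ q _ hpq
    refine Finset.disjoint_left.2 fun s hs hs' => hpq ?_
    rw [Finset.mem_powersetCard] at hs hs'
    obtain ⟨x, hx⟩ := Finset.card_pos.1 (by omega : 0 < s.card)
    rw [← (Finset.mem_filter.1 (hs.1 hx)).2, (Finset.mem_filter.1 (hs'.1 hx)).2]

end Profile

lemma Nat.card_quot_eq_ncard_range {α β : Type*} {r : α → α → Prop} (F : α → β)
    (h : ∀ a b, r a b ↔ F a = F b) : Nat.card (Quot r) = (Set.range F).ncard := by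
  rw [← Nat.card_coe_set_eq]
  refine Nat.card_congr (Equiv.ofBijective
    (Quot.lift (Set.rangeFactorization F) fun a b hab => Subtype.ext ((h a b).1 hab)) ⟨?_, ?_⟩)
  · rintro ⟨a⟩ ⟨b⟩ hab
    exact Quot.sound ((h a b).2 (congrArg Subtype.val hab))
  · rintro ⟨_, a, rfl⟩
    exact ⟨Quot.mk r a, rfl⟩

lemma intervalOrderCount_eq_card (n : ℕ) : intervalOrderCount n = (fishburnMultisets n).card := by
  rw [intervalOrderCount, Nat.card_quot_eq_ncard_range profile fun _ _ => profile_eq_iff,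
    ← Set.ncard_coe_finset]
  congr 1
  ext m
  constructor
  · rintro ⟨P, rfl⟩
    exact profile_mem_fishburnMultisets P
  · exact exists_profile_eq

lemma card_quot_dupPairCount_eq (n k : ℕ) :
    Nat.card (Quot fun (P Q : {P : IntervalOrderRel n // dupPairCount P = k}) =>
      IntervalOrderIso P.1 Q.1) =
    ((fishburnMultisets n).filter fun m => m.pairCount = k).card := by
  rw [Nat.card_quot_eq_ncard_range (r := fun (P Q : {P : IntervalOrderRel n // dupPairCount P = k}) =>
    IntervalOrderIso P.1 Q.1) (fun P => profile P.1) fun _ _ => profile_eq_iff,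
    ← Set.ncard_coe_finset]
  congr 1
  ext m
  rw [Finset.mem_coe, Finset.mem_filter]
  constructor
  · rintro ⟨P, rfl⟩
    exact ⟨profile_mem_fishburnMultisets P.1, by rw [← dupPairCount_eq_pairCount, P.2]⟩
  · rintro ⟨hm, hk⟩
    obtain ⟨P, rfl⟩ := exists_profile_eq hm
    exact ⟨⟨P, by rw [dupPairCount_eq_pairCount, hk]⟩, rfl⟩

/-- For each fixed `k`, the proportion of unlabelled `n`-element
interval orders with exactly `k` unordered pairs of distinct elements with
duplicated holdings tends to `e^{-π²/6} (π²/6)^k / k!` as `n → ∞` (Poisson with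
mean `π²/6`). -/
theorem unlabelled_dup_pairs_poisson (k : ℕ) :
    Filter.Tendsto
      (fun n : ℕ =>
        (Nat.card (Quot fun (P Q : {P : IntervalOrderRel n // dupPairCount P = k}) =>
            IntervalOrderIso P.1 Q.1) : ℝ) / (intervalOrderCount n : ℝ))
      Filter.atTop
      (nhds (Real.exp (-(Real.pi ^ 2 / 6)) * (Real.pi ^ 2 / 6) ^ k / k.factorial)) := by
  simp only [card_quot_dupPairCount_eq, intervalOrderCount_eq_card]
  exact tendsto_card_pairCount_div k
end

section
/- For every n ≥ 2, the number of unlabelled n-element interval orders that contain three distinct elements pairwise having duplicated holdings is at most (n−2) · i_{n-2}, where i_m is the number of unlabelled interval orders on m points. -/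
open scoped Classical

/-- The interval order obtained by pulling back along a map of the ground sets. -/
def IntervalOrderRel.comap {m n : ℕ} (P : IntervalOrderRel m) (f : Fin n → Fin m) :
    IntervalOrderRel n :=
  ⟨fun a b => P.1 (f a) (f b),
    { irrefl := fun a => P.2.1.irrefl (f a)
      trans := fun a b c => P.2.1.trans (f a) (f b) (f c) },
    fun a b c d => P.2.2 (f a) (f b) (f c) (f d)⟩

theorem intervalOrderIso_equivalence (n : ℕ) :
    Equivalence (IntervalOrderIso (n := n)) where
  refl _ := ⟨1, fun _ _ => Iff.rfl⟩
  symm := fun ⟨e, he⟩ => ⟨e.symm, fun a b => by simp [he]⟩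
  trans := fun ⟨e, he⟩ ⟨f, hf⟩ => ⟨e.trans f, fun a b => (he a b).trans (hf _ _)⟩

instance (n : ℕ) : Finite (IntervalOrderRel n) :=
  inferInstanceAs (Finite (Subtype _))

/-- Two elements with the same strict lower and upper sets, possibly equal. -/
def SameHoldings {n : ℕ} (P : IntervalOrderRel n) (x y : Fin n) : Prop :=
  (∀ z, P.1 z x ↔ P.1 z y) ∧ (∀ z, P.1 x z ↔ P.1 y z)

/-- The map `Fin (m + 2) → Fin m` whose fibre over `i` gains the two extra points `0` and `1`. -/
def triplingMap {m : ℕ} (i : Fin m) : Fin (m + 2) → Fin m :=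
  Fin.cons i (Fin.cons i id)

theorem hasDupTriple_comap_triplingMap {m : ℕ} (P : IntervalOrderRel m) (i : Fin m) :
    HasDupTriple (P.comap (triplingMap i)) := by
  have h0 : triplingMap i 0 = i := rfl
  have h1 : triplingMap i 1 = i := rfl
  have h2 : triplingMap i i.succ.succ = i := rfl
  have h01 : (0 : Fin (m + 2)) ≠ 1 := by simp
  have h02 : (0 : Fin (m + 2)) ≠ i.succ.succ := (Fin.succ_ne_zero _).symm
  have h12 : (1 : Fin (m + 2)) ≠ i.succ.succ := by
    intro h
    simpa using congrArg Fin.val h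
  refine ⟨0, 1, i.succ.succ, h01, h02, h12, ⟨h01, ?_⟩, ⟨h02, ?_⟩, ⟨h12, ?_⟩⟩ <;>
    simp [IntervalOrderRel.comap, h0, h1, h2]

/-- An interval order with a duplicated triple arises, up to isomorphism, by tripling a point of
any interval order isomorphic to the one left after deleting two points of the triple. -/
theorem exists_iso_comap_triplingMap {m : ℕ} (P : IntervalOrderRel (m + 2))
    (hP : HasDupTriple P) :
    ∃ Q : IntervalOrderRel m, ∀ R, IntervalOrderIso R Q →
      ∃ i, IntervalOrderIso (R.comap (triplingMap i)) P := by
  obtain ⟨x, y, z, hxy, hxz, hyz, dxy, dxz, -⟩ := hP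
  have hcard : Fintype.card {a // a ∈ ({y, z} : Finset (Fin (m + 2)))ᶜ} =
      Fintype.card (Fin m) := by
    rw [Fintype.card_coe, Finset.card_compl, Finset.card_pair hyz]
    simp
  let h := (Fintype.equivOfCardEq hcard).symm
  refine ⟨P.comap fun a => h a, fun R ⟨e, he⟩ => ?_⟩
  let k := e.trans h
  have hk : ∀ a, (k a : Fin (m + 2)) ≠ y ∧ (k a : Fin (m + 2)) ≠ z := fun a => by
    simpa using (k a).2
  obtain ⟨i, hi⟩ := k.surjective ⟨x, by simp [hxy, hxz]⟩
  have hix : (k i : Fin (m + 2)) = x := by rw [hi]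
  let φ : Fin (m + 2) → Fin (m + 2) := Fin.cons y (Fin.cons z fun a => (k a : Fin (m + 2)))
  have hφ : Function.Injective φ := by
    refine Fin.cons_injective_iff.2 ⟨?_, Fin.cons_injective_iff.2 ⟨?_, ?_⟩⟩
    · rintro ⟨a, ha⟩
      induction a using Fin.cases with
      | zero => exact hyz ha.symm
      | succ a => exact (hk a).1 ha
    · rintro ⟨a, ha⟩
      exact (hk a).2 ha
    · exact Subtype.val_injective.comp k.injective
  have hsame : ∀ a, SameHoldings P (k (triplingMap i a)) (φ a) := by
    intro a
    induction a using Fin.cases with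
    | zero =>
      change SameHoldings P (k i) y
      exact hix ▸ dxy.2
    | succ a =>
      induction a using Fin.cases with
      | zero =>
        change SameHoldings P (k i) z
        exact hix ▸ dxz.2
      | succ a => exact ⟨fun _ => Iff.rfl, fun _ => Iff.rfl⟩
  exact ⟨i, Equiv.ofBijective φ (Finite.injective_iff_bijective.1 hφ), fun a b =>
    (he _ _).trans (((hsame a).2 _).trans ((hsame b).1 _))⟩

/-- For `n ≥ 2`, the number of unlabelled `n`-element interval
orders containing three distinct elements pairwise with duplicated holdings is at
most `(n - 2) · i_{n-2}`. -/
theorem unlabelled_with_dup_triple_bound (n : ℕ) (hn : 2 ≤ n) :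
    Nat.card (Quot fun (P Q : {P : IntervalOrderRel n // HasDupTriple P}) =>
        IntervalOrderIso P.1 Q.1) ≤
      (n - 2) * intervalOrderCount (n - 2) := by
  obtain ⟨m, rfl⟩ := Nat.exists_eq_add_of_le' hn
  have hcard : m * intervalOrderCount m =
      Nat.card (Fin m × Quot (IntervalOrderIso (n := m))) := by
    rw [Nat.card_prod, Nat.card_fin, intervalOrderCount]
  rw [Nat.add_sub_cancel, hcard]
  refine Nat.card_le_card_of_surjective
    (fun p => Quot.mk _ ⟨p.2.out.comap (triplingMap p.1), hasDupTriple_comap_triplingMap _ _⟩) ?_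
  rintro ⟨P, hP⟩
  obtain ⟨Q, hQ⟩ := exists_iso_comap_triplingMap P hP
  obtain ⟨i, hi⟩ := hQ (Quot.mk _ Q).out
    ((intervalOrderIso_equivalence m).quot_mk_eq_iff _ _ |>.1 (Quot.out_eq _))
  exact ⟨(i, Quot.mk _ Q), Quot.sound hi⟩
end

section
/- For every n ≥ 1, the number ℓ_n of labelled interval orders on the set {1, …, n} satisfies ℓ_n ≤ (2n)! / 2^n. -/
open scoped Classical

/-- A finite type injecting into a linear order can be enumerated increasingly. -/
theorem exists_equiv_fin_lt_iff {α β : Type*} [Fintype α] [LinearOrder β] {m : ℕ}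
    (hm : Fintype.card α = m) (g : α → β) (hg : Function.Injective g) :
    ∃ e : α ≃ Fin m, ∀ x y, e x < e y ↔ g x < g y := by
  let _ : LinearOrder α := LinearOrder.lift' g hg
  exact ⟨(Fintype.orderIsoFinOfCardEq α hm).symm.toEquiv, fun x y =>
    (Fintype.orderIsoFinOfCardEq α hm).symm.lt_iff_lt⟩

namespace IntervalOrderRel

/-- The left endpoint of the interval of `b`: the number of its predecessors. -/
noncomputable def left {n : ℕ} (P : IntervalOrderRel n) (b : Fin n) : ℕ :=
  (Finset.univ.filter fun z => P.1 z b).card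

/-- The right endpoint of the interval of `a`: the largest left endpoint of an element
that is not above `a`. -/
noncomputable def right {n : ℕ} (P : IntervalOrderRel n) (a : Fin n) : ℕ :=
  (Finset.univ.filter fun b => ¬ P.1 a b).sup P.left

theorem left_le_right_iff {n : ℕ} (P : IntervalOrderRel n) (a b : Fin n) :
    P.left b ≤ P.right a ↔ ¬ P.1 a b := by
  refine ⟨fun h hab => ?_, fun h => Finset.le_sup (f := P.left) (by simpa using h)⟩
  obtain ⟨hstrict, hP⟩ := P.2
  obtain ⟨c, hc, hcsup⟩ := Finset.exists_mem_eq_sup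
    (Finset.univ.filter fun b => ¬ P.1 a b)
    ⟨a, by simpa using hstrict.irrefl a⟩ P.left
  replace hc : ¬ P.1 a c := by simpa using hc
  have hlt : P.left c < P.left b := by
    refine Finset.card_lt_card (Finset.ssubset_iff_of_subset ?_ |>.2 ⟨a, by simpa, by simpa⟩)
    intro z hz
    have hzc : P.1 z c := by simpa using hz
    have := hP a b z c hab hzc
    simp only [Finset.mem_filter, Finset.mem_univ, true_and]
    tauto
  exact absurd h (not_le.2 (hcsup.trans_lt hlt))

/-- Every interval order has an interval representation with distinct endpoints. -/
theorem exists_endpoint_enumeration {n : ℕ} (P : IntervalOrderRel n) :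
    ∃ e : Fin n × Bool ≃ Fin (2 * n),
      (∀ a, e (a, false) < e (a, true)) ∧ ∀ a b, P.1 a b ↔ e (a, true) < e (b, false) := by
  let g : Fin n × Bool → ℕ ×ₗ Bool ×ₗ Fin n := fun x =>
    toLex (if x.2 then P.right x.1 else P.left x.1, toLex (x.2, x.1))
  have hg : Function.Injective g := by
    rintro ⟨a, s⟩ ⟨b, t⟩ h
    have h' := congrArg (fun z => ofLex (ofLex z).2) h
    simp only [g, ofLex_toLex, Prod.mk.injEq] at h'
    rw [h'.1, h'.2]
  obtain ⟨e, he⟩ := exists_equiv_fin_lt_iff (m := 2 * n) (by simp [mul_comm]) g hg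
  have key (a b : Fin n) : e (b, false) < e (a, true) ↔ ¬ P.1 a b := by
    rw [he, ← P.left_le_right_iff, le_iff_lt_or_eq]
    simp [g, Prod.Lex.toLex_lt_toLex]
  refine ⟨e, fun a => (key a a).2 (P.2.1.irrefl a), fun a b => ?_⟩
  have hne : e (a, true) ≠ e (b, false) := fun h => by simpa using e.injective h
  rw [← not_iff_not, ← key, not_lt]
  exact ⟨le_of_lt, fun h => lt_of_le_of_ne h hne.symm⟩

end IntervalOrderRel

/-- Exchange the two endpoints of those intervals selected by `f`. -/
def endpointSwap {ι : Type*} (f : ι → Bool) : Equiv.Perm (ι × Bool) :=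
  Function.Involutive.toPerm (fun x => (x.1, x.2 ^^ f x.1)) fun x => by simp

@[simp]
theorem endpointSwap_apply {ι : Type*} (f : ι → Bool) (x : ι × Bool) :
    endpointSwap f x = (x.1, x.2 ^^ f x.1) := rfl

theorem two_pow_mul_labelledIntervalOrderCount_le (n : ℕ) :
    2 ^ n * labelledIntervalOrderCount n ≤ (2 * n).factorial := by
  choose e he hrel using IntervalOrderRel.exists_endpoint_enumeration (n := n)
  let F : (Fin n → Bool) × IntervalOrderRel n → (Fin n × Bool ≃ Fin (2 * n)) :=
    fun x => (endpointSwap x.1).trans (e x.2)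
  have hF : Function.Injective F := by
    rintro ⟨f, P⟩ ⟨f', Q⟩ h
    have hf : f = f' := by
      funext a
      have h0 : e P (a, f a) = e Q (a, f' a) := by
        simpa [F] using DFunLike.congr_fun h (a, false)
      have h1 : e P (a, !f a) = e Q (a, !f' a) := by
        simpa [F] using DFunLike.congr_fun h (a, true)
      have hP := he P a
      have hQ := he Q a
      cases hfa : f a <;> cases hfa' : f' a <;> simp only [hfa, hfa', Bool.not_true,
        Bool.not_false] at h0 h1 ⊢
      · rw [h0, h1] at hP
        exact absurd hP hQ.asymm
      · rw [h0, h1] at hP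
        exact absurd hP hQ.asymm
    subst hf
    have heq : e P = e Q := by
      ext x
      have := DFunLike.congr_fun h ((endpointSwap f).symm x)
      simp only [F, Equiv.trans_apply, Equiv.apply_symm_apply] at this
      rw [this]
    congr 1
    apply Subtype.ext
    funext a b
    rw [eq_iff_iff, hrel, hrel, heq]
  have hcard := Nat.card_le_card_of_injective F hF
  have hequiv : Nat.card (Fin n × Bool ≃ Fin (2 * n)) = (2 * n).factorial := by
    rw [Nat.card_eq_fintype_card,
      Fintype.card_equiv (Fintype.equivFinOfCardEq (by simp [mul_comm]))]
    simp [mul_comm]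
  rw [Nat.card_prod, hequiv] at hcard
  simpa [labelledIntervalOrderCount] using hcard

/-- For `n ≥ 1`, `ℓ_n ≤ (2n)! / 2^n`. -/
theorem labelled_upper_bound (n : ℕ) (hn : 1 ≤ n) :
    (labelledIntervalOrderCount n : ℝ) ≤ (2 * n).factorial / 2 ^ n := by
  rw [le_div_iff₀ (by positivity), mul_comm]
  exact_mod_cast two_pow_mul_labelledIntervalOrderCount_le n
end

section
/- There is a constant C > 0 such that for all sufficiently large n, the number ℓ_n of labelled interval orders on {1, …, n} satisfies ℓ_n ≥ n^{2n − C·n·log log n / log n}. -/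
open scoped Classical

/-- The interval order on `Fin n` given by natural-number intervals `[l x, r x]`. -/
def intervalOrderOfEndpoints {n : ℕ} (l r : Fin n → ℕ) (h : ∀ x, l x ≤ r x) :
    IntervalOrderRel n :=
  ⟨fun x y => r x < l y,
    { irrefl := fun x hx => absurd (h x) (not_le.2 hx)
      trans := fun x y z hxy hyz => lt_trans (lt_of_lt_of_le hxy (h y)) hyz },
    fun a b c d hab hcd => by
      change r a < l b at hab
      change r c < l d at hcd
      change r a < l d ∨ r c < l b
      omega⟩

/-- Left endpoints: the first `2 * k` elements are points, the others start in `[0, k)`. -/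
def leftEndpoint {n k : ℕ} (g : Fin (n - 2 * k) → Fin k × Fin k) (x : Fin n) : ℕ :=
  if h : x.1 < 2 * k then x.1 else (g ⟨x.1 - 2 * k, by omega⟩).1

/-- Right endpoints: the first `2 * k` elements are points, the others end in `[k, 2 * k)`. -/
def rightEndpoint {n k : ℕ} (g : Fin (n - 2 * k) → Fin k × Fin k) (x : Fin n) : ℕ :=
  if h : x.1 < 2 * k then x.1 else k + (g ⟨x.1 - 2 * k, by omega⟩).2

theorem leftEndpoint_le_rightEndpoint {n k : ℕ} (g : Fin (n - 2 * k) → Fin k × Fin k)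
    (x : Fin n) : leftEndpoint g x ≤ rightEndpoint g x := by
  unfold leftEndpoint rightEndpoint
  split_ifs <;> omega

theorem intervalOrderOfEndpoints_injective {n k : ℕ} (hk : 2 * k ≤ n) :
    Function.Injective fun g : Fin (n - 2 * k) → Fin k × Fin k =>
      intervalOrderOfEndpoints (leftEndpoint g) (rightEndpoint g)
        (leftEndpoint_le_rightEndpoint g) := by
  intro g g' hg
  have hrel : ∀ x y : Fin n, rightEndpoint g x < leftEndpoint g y ↔
      rightEndpoint g' x < leftEndpoint g' y := fun x y =>
    iff_of_eq (congrFun (congrFun (congrArg Subtype.val hg) x) y)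
  funext j
  have hleft : ∀ i : ℕ, i < 2 * k → (i < (g j).1.1 ↔ i < (g' j).1.1) := by
    intro i hi
    have := hrel ⟨i, by omega⟩ ⟨j.1 + 2 * k, by omega⟩
    simpa [leftEndpoint, rightEndpoint, hi] using this
  have hright : ∀ i : ℕ, i < 2 * k → (k + (g j).2.1 < i ↔ k + (g' j).2.1 < i) := by
    intro i hi
    have := hrel ⟨j.1 + 2 * k, by omega⟩ ⟨i, by omega⟩
    simpa [leftEndpoint, rightEndpoint, hi] using this
  have h1 := hleft (g j).1.1 (by omega)
  have h2 := hleft (g' j).1.1 (by omega)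
  have h3 := hright (k + (g j).2.1) (by omega)
  have h4 := hright (k + (g' j).2.1) (by omega)
  refine Prod.ext (Fin.ext ?_) (Fin.ext ?_) <;> omega

theorem pow_le_labelledIntervalOrderCount {n k : ℕ} (hk : 2 * k ≤ n) :
    (k * k) ^ (n - 2 * k) ≤ labelledIntervalOrderCount n := by
  have : Finite (IntervalOrderRel n) := by
    unfold IntervalOrderRel
    infer_instance
  simpa [labelledIntervalOrderCount] using
    Nat.card_le_card_of_injective _ (intervalOrderOfEndpoints_injective hk)

/-- There is a constant `C > 0` such that for all sufficiently
large `n`, `ℓ_n ≥ n^{2n - C n log log n / log n}`. -/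
theorem labelled_lower_bound :
    ∃ C : ℝ, 0 < C ∧ ∀ᶠ n : ℕ in Filter.atTop,
      (n : ℝ) ^ (2 * (n : ℝ) - C * n * Real.log (Real.log n) / Real.log n) ≤
        (labelledIntervalOrderCount n : ℝ) := by
  refine ⟨10, by norm_num, ?_⟩
  have hlog : Filter.Tendsto (fun n : ℕ => Real.log n) Filter.atTop Filter.atTop :=
    Real.tendsto_log_atTop.comp tendsto_natCast_atTop_atTop
  filter_upwards [hlog.eventually_ge_atTop 4,
    (Real.tendsto_log_atTop.comp hlog).eventually_ge_atTop 1,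
    Filter.eventually_ge_atTop 1] with n hL hLL hn
  simp only [Function.comp_apply] at hLL
  have hn0 : (0 : ℝ) < n := by exact_mod_cast hn
  have hLn : Real.log n ≤ n := (Real.log_le_sub_one_of_pos hn0).trans (by linarith)
  have hLLL : Real.log (Real.log n) ≤ Real.log n :=
    (Real.log_le_sub_one_of_pos (by linarith)).trans (by linarith)
  set L := Real.log n with hLdef
  set M := Real.log L
  have hL0 : 0 < L := by linarith
  set k := ⌈(n : ℝ) / L⌉₊
  have hone : 1 ≤ (n : ℝ) / L := (one_le_div hL0).2 hLn
  have hk1 : (n : ℝ) / L ≤ k := Nat.le_ceil _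
  have hk2 : (k : ℝ) ≤ 2 * (n / L) := by
    have := Nat.ceil_lt_add_one (a := (n : ℝ) / L) (by positivity)
    linarith
  have hquot : (n : ℝ) / L * L = n := div_mul_cancel₀ _ hL0.ne'
  have hk3 : 2 * (k : ℝ) ≤ n := by nlinarith
  have hk4 : 2 * k ≤ n := by exact_mod_cast hk3
  have hk0 : (0 : ℝ) < k := by linarith
  have hlogk : L - M ≤ Real.log k := by
    rw [hLdef, ← Real.log_div hn0.ne' hL0.ne']
    exact Real.log_le_log (by positivity) hk1
  refine le_trans ?_ (Nat.cast_le.2 (pow_le_labelledIntervalOrderCount hk4))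
  rw [Nat.cast_pow, Nat.cast_mul, ← Real.log_le_log_iff (by positivity) (by positivity),
    Real.log_rpow hn0, Real.log_pow, Real.log_mul hk0.ne' hk0.ne', Nat.cast_sub hk4, ← hLdef]
  push_cast
  have hexp : (2 * (n : ℝ) - 10 * n * M / L) * L = 2 * (n * L) - 10 * (n * M) := by
    field_simp
  rw [hexp]
  have hprod : ((n : ℝ) - 4 * (n / L)) * (L - M) ≤ (n - 2 * k) * Real.log k :=
    mul_le_mul (by linarith) hlogk (by linarith) (by linarith)
  have hpos : 0 ≤ (n : ℝ) / L * M := by positivity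
  nlinarith [mul_le_mul_of_nonneg_left hLL hn0.le]
end

section
/- For each fixed j ≥ 0, the Stirling numbers of the second kind satisfy S(n, n−j) · j! · 2^j / (n−j)^{2j} → 1 as n → ∞; that is, S(n, n−j) ∼ (n−j)^{2j} / (j! · 2^j). -/
open scoped Classical

/-- The equivalence relation on `Option α` which extends `r` by putting `none` in the class `o`,
or in a class of its own if `o = none`. -/
def Setoid.optionExtend {α : Type*} (r : Setoid α) (o : Option (Quotient r)) :
    Setoid (Option α) :=
  Setoid.ker fun x : Option α => x.elim o fun a => some (Quotient.mk r a)

theorem Setoid.optionExtend_some_some {α : Type*} (r : Setoid α) (o : Option (Quotient r))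
    (a b : α) : r.optionExtend o (some a) (some b) ↔ r a b :=
  (Option.some_inj (a := Quotient.mk r a) (b := Quotient.mk r b)).trans Quotient.eq

theorem Setoid.optionExtend_none_some {α : Type*} (r : Setoid α) (o : Option (Quotient r))
    (a : α) : r.optionExtend o none (some a) ↔ o = some (Quotient.mk r a) :=
  Iff.rfl

theorem Setoid.optionExtend_bijective (α : Type*) :
    Function.Bijective
      (fun x : Σ r : Setoid α, Option (Quotient r) => x.1.optionExtend x.2) := by
  constructor
  · rintro ⟨r, o⟩ ⟨r', o'⟩ h
    have hrel : ∀ x y, r.optionExtend o x y ↔ r'.optionExtend o' x y := fun x y => by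
      simp only at h
      rw [h]
    obtain rfl : r = r' := Setoid.ext fun a b => by
      simpa only [optionExtend_some_some] using hrel (some a) (some b)
    obtain rfl : o = o' := by
      refine Option.ext fun q => ?_
      induction q using Quotient.inductionOn with
      | h a => simpa only [optionExtend_none_some] using hrel none (some a)
    rfl
  · intro R
    let r : Setoid α := R.comap some
    have key : ∀ o : Option (Quotient r),
        (∀ a, o = some (Quotient.mk r a) ↔ R none (some a)) → r.optionExtend o = R := by
      intro o ho
      refine Setoid.ext fun x y => ?_
      cases x with
      | none =>
        cases y with
        | none => exact iff_of_true (Setoid.refl' _ _) (Setoid.refl' _ _)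
        | some b => rw [optionExtend_none_some, ho]
      | some a =>
        cases y with
        | none => rw [Setoid.comm', optionExtend_none_some, ho, Setoid.comm']
        | some b => rw [optionExtend_some_some]; rfl
    by_cases h : ∃ a, R none (some a)
    · obtain ⟨a, ha⟩ := h
      refine ⟨⟨r, some (Quotient.mk r a)⟩, key _ fun b => ?_⟩
      rw [Option.some.injEq, Quotient.eq]
      exact ⟨fun hab => R.trans' ha hab, fun hb => R.trans' (R.symm' ha) hb⟩
    · exact ⟨⟨r, none⟩, key _ fun b => by simpa using fun hb => h ⟨b, hb⟩⟩

theorem Setoid.card_quotient_optionExtend_none {α : Type*} [Finite α] (r : Setoid α) :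
    Nat.card (Quotient (r.optionExtend none)) = Nat.card (Quotient r) + 1 := by
  rw [optionExtend, Nat.card_congr (Setoid.quotientKerEquivOfSurjective _ ?_),
    Finite.card_option]
  rintro (_ | q)
  · exact ⟨none, rfl⟩
  · induction q using Quotient.inductionOn with
    | h a => exact ⟨some a, rfl⟩

theorem Setoid.card_quotient_optionExtend_some {α : Type*} (r : Setoid α)
    (q : Quotient r) :
    Nat.card (Quotient (r.optionExtend (some q))) = Nat.card (Quotient r) := by
  have h : r.optionExtend (some q) =
      Setoid.ker fun x : Option α => x.elim q (Quotient.mk r) :=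
    Setoid.ext fun x y => by cases x <;> cases y <;> exact Option.some_inj
  rw [h, Nat.card_congr (Setoid.quotientKerEquivOfSurjective _ ?_)]
  intro q'
  induction q' using Quotient.inductionOn with
  | h a => exact ⟨some a, rfl⟩

theorem Nat.card_subtype_eq_sum_ite {β : Type*} [Fintype β] (p : β → Prop) [DecidablePred p] :
    Nat.card {x // p x} = ∑ x, if p x then 1 else 0 := by
  rw [Nat.card_eq_fintype_card, Fintype.card_subtype, Finset.card_filter]

instance Setoid.instFinite {α : Type*} [Finite α] : Finite (Setoid α) :=
  Finite.of_injective (fun r : Setoid α => (fun a b => r a b : α → α → Prop)) fun _ _ h =>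
    Setoid.ext fun a b => iff_of_eq (congrFun (congrFun h a) b)

theorem Setoid.card_option_succ (α : Type*) [Finite α] (k : ℕ) :
    Nat.card {R : Setoid (Option α) // Nat.card (Quotient R) = k + 1} =
      (k + 1) * Nat.card {r : Setoid α // Nat.card (Quotient r) = k + 1} +
        Nat.card {r : Setoid α // Nat.card (Quotient r) = k} := by
  have : Fintype (Setoid (Option α)) := Fintype.ofFinite _
  have : Fintype (Setoid α) := Fintype.ofFinite _
  have (r : Setoid α) : Fintype (Quotient r) := Fintype.ofFinite _
  rw [Nat.card_subtype_eq_sum_ite, Nat.card_subtype_eq_sum_ite, Nat.card_subtype_eq_sum_ite,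
    ← (Setoid.optionExtend_bijective α).sum_comp, Fintype.sum_sigma, Finset.mul_sum,
    ← Finset.sum_add_distrib]
  refine Finset.sum_congr rfl fun r _ => ?_
  rw [Fintype.sum_option]
  simp only [card_quotient_optionExtend_none, card_quotient_optionExtend_some,
    Finset.sum_const, Finset.card_univ, ← Nat.card_eq_fintype_card]
  simp only [Nat.add_right_cancel_iff, smul_eq_mul, mul_ite, mul_one, mul_zero]
  split_ifs <;> omega

theorem Setoid.card_congr {α β : Type*} (e : α ≃ β) (k : ℕ) :
    Nat.card {r : Setoid α // Nat.card (Quotient r) = k} =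
      Nat.card {r : Setoid β // Nat.card (Quotient r) = k} := by
  have h (r : Setoid β) : Nat.card (Quotient (r.comap e)) = Nat.card (Quotient r) :=
    Nat.card_congr (Quotient.congr e fun _ _ => Iff.rfl)
  refine (Nat.card_congr (Equiv.ofBijective
    (fun r => ⟨r.1.comap e, (h r.1).trans r.2⟩) ⟨fun r s hrs => ?_, fun r => ?_⟩)).symm
  · refine Subtype.ext (Setoid.ext fun a b => ?_)
    have := Setoid.ext_iff.1 (congrArg Subtype.val hrs) (e.symm a) (e.symm b)
    simpa [Setoid.comap_rel] using this
  · have hr : (r.1.comap e.symm).comap e = r.1 :=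
      Setoid.ext fun a b => by simp [Setoid.comap_rel]
    exact ⟨⟨r.1.comap e.symm, by rw [← h, hr, r.2]⟩, Subtype.ext hr⟩

theorem Setoid.card_fin_eq_stirlingSecond (n k : ℕ) :
    Nat.card {r : Setoid (Fin n) // Nat.card (Quotient r) = k} = n.stirlingSecond k := by
  induction n generalizing k with
  | zero =>
    have : Unique (Setoid (Fin 0)) := ⟨⟨⊥⟩, fun r => Setoid.ext fun a => a.elim0⟩
    cases k with
    | zero => simp
    | succ k => simp
  | succ n ih =>
    cases k with
    | zero =>
      have : IsEmpty {r : Setoid (Fin (n + 1)) // Nat.card (Quotient r) = 0} :=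
        ⟨fun r => (Nat.card_pos (α := Quotient r.1)).ne' r.2⟩
      simp
    | succ k =>
      rw [Setoid.card_congr (finSuccEquiv n), Setoid.card_option_succ, ih, ih,
        Nat.stirlingSecond_succ_succ]

theorem Finpartition.card_quotient_ker_part {α : Type*} [Fintype α] [DecidableEq α]
    (P : Finpartition (Finset.univ : Finset α)) :
    Nat.card (Quotient (Setoid.ker P.part)) = P.parts.card := by
  have h : Set.range P.part = P.parts := by
    ext t
    refine ⟨?_, fun ht => ?_⟩
    · rintro ⟨a, rfl⟩
      exact P.part_mem.2 (Finset.mem_univ a)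
    · obtain ⟨a, -, ha⟩ := P.part_surjOn ht
      exact ⟨a, ha⟩
  rw [Nat.card_congr (Setoid.quotientKerEquivRange P.part), h]
  simp

theorem Finpartition.ker_part_bijective (α : Type*) [Fintype α] [DecidableEq α] :
    Function.Bijective
      (fun P : Finpartition (Finset.univ : Finset α) => Setoid.ker P.part) := by
  constructor
  · intro P Q h
    have hpart : P.part = Q.part := by
      funext a
      ext b
      have := Setoid.ext_iff.1 h b a
      simp only [Setoid.ker_def] at this
      rwa [← P.mem_part_iff_part_eq_part (Finset.mem_univ _) (Finset.mem_univ _),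
        ← Q.mem_part_iff_part_eq_part (Finset.mem_univ _) (Finset.mem_univ _)] at this
    refine Finpartition.ext (Finset.coe_injective ?_)
    have hrange (P : Finpartition (Finset.univ : Finset α)) :
        P.part '' (Finset.univ : Finset α) = P.parts :=
      P.part_surjOn.image_eq_of_mapsTo fun a ha => P.part_mem.2 ha
    rw [← hrange P, ← hrange Q, hpart]
  · intro r
    refine ⟨Finpartition.ofSetoid r, Setoid.ext fun a b => ?_⟩
    rw [Setoid.ker_def, ← Finpartition.mem_part_iff_part_eq_part _ (Finset.mem_univ _)
      (Finset.mem_univ _), Finpartition.mem_part_ofSetoid_iff_rel, Setoid.comm']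

theorem stirling2_eq_stirlingSecond (n k : ℕ) : stirling2 n k = n.stirlingSecond k := by
  rw [stirling2, ← Setoid.card_fin_eq_stirlingSecond]
  refine Nat.card_congr ((Equiv.ofBijective _
    (Finpartition.ker_part_bijective (Fin n))).subtypeEquiv fun P => ?_)
  rw [Equiv.ofBijective_apply, Finpartition.card_quotient_ker_part]

theorem Nat.add_one_pow_le_pow_add (x m : ℕ) :
    (x + 1) ^ (m + 1) ≤ x ^ (m + 1) + (m + 1) * (x + 1) ^ m := by
  induction m with
  | zero => simp
  | succ m ih =>
    calc (x + 1) ^ (m + 1 + 1) = x * (x + 1) ^ (m + 1) + (x + 1) ^ (m + 1) := by ring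
      _ ≤ x * (x ^ (m + 1) + (m + 1) * (x + 1) ^ m) + (x + 1) ^ (m + 1) := by gcongr
      _ = x ^ (m + 1 + 1) + (m + 1) * (x * (x + 1) ^ m) + (x + 1) ^ (m + 1) := by ring
      _ ≤ x ^ (m + 1 + 1) + (m + 1) * ((x + 1) * (x + 1) ^ m) + (x + 1) ^ (m + 1) := by
        gcongr
        exact Nat.le_succ x
      _ = x ^ (m + 1 + 1) + (m + 1 + 1 : ℕ) * (x + 1) ^ (m + 1) := by ring

theorem Nat.pow_add_le_add_one_pow (x m : ℕ) :
    x ^ (m + 1) + (m + 1) * x ^ m ≤ (x + 1) ^ (m + 1) := by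
  induction m with
  | zero => simp
  | succ m ih =>
    calc x ^ (m + 1 + 1) + (m + 1 + 1 : ℕ) * x ^ (m + 1)
        ≤ (x + 1) * (x ^ (m + 1) + (m + 1) * x ^ m) := by
          ring_nf
          omega
      _ ≤ (x + 1) * (x + 1) ^ (m + 1) := by gcongr
      _ = (x + 1) ^ (m + 1 + 1) := by ring

theorem Nat.pow_le_stirlingSecond_mul (j k : ℕ) :
    k ^ (2 * j) ≤ (k + j).stirlingSecond k * j.factorial * 2 ^ j := by
  induction j generalizing k with
  | zero => simp [Nat.stirlingSecond_self]
  | succ j ihj =>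
    induction k with
    | zero => simp
    | succ k ihk =>
      have hrec : (k + 1 + (j + 1)).stirlingSecond (k + 1) =
          (k + 1) * (k + 1 + j).stirlingSecond (k + 1) + (k + (j + 1)).stirlingSecond k := by
        rw [← add_assoc (k + 1) j 1, Nat.stirlingSecond_succ_succ,
          show k + 1 + j = k + (j + 1) by ring]
      have := ihj (k + 1)
      calc (k + 1) ^ (2 * (j + 1))
          ≤ k ^ (2 * (j + 1)) + (2 * j + 1 + 1 : ℕ) * (k + 1) ^ (2 * j + 1) :=
            Nat.add_one_pow_le_pow_add k (2 * j + 1)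
        _ = k ^ (2 * (j + 1)) + (k + 1) * (j + 1) * 2 * (k + 1) ^ (2 * j) := by
            ring
        _ ≤ (k + (j + 1)).stirlingSecond k * (j + 1).factorial * 2 ^ (j + 1) +
            (k + 1) * (j + 1) * 2 * ((k + 1 + j).stirlingSecond (k + 1) * j.factorial * 2 ^ j) := by
            gcongr
        _ = _ := by rw [hrec, Nat.factorial_succ]; ring

theorem Nat.stirlingSecond_mul_le_pow (j k : ℕ) :
    (k + j).stirlingSecond k * j.factorial * 2 ^ j ≤ (k + j) ^ (2 * j) := by
  induction j generalizing k with
  | zero => simp [Nat.stirlingSecond_self]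
  | succ j ihj =>
    induction k with
    | zero => simp
    | succ k ihk =>
      have hrec : (k + 1 + (j + 1)).stirlingSecond (k + 1) =
          (k + 1) * (k + 1 + j).stirlingSecond (k + 1) + (k + (j + 1)).stirlingSecond k := by
        rw [← add_assoc (k + 1) j 1, Nat.stirlingSecond_succ_succ,
          show k + 1 + j = k + (j + 1) by ring]
      have := ihj (k + 1)
      calc (k + 1 + (j + 1)).stirlingSecond (k + 1) * (j + 1).factorial * 2 ^ (j + 1)
          = (k + (j + 1)).stirlingSecond k * (j + 1).factorial * 2 ^ (j + 1) +
            (k + 1) * (j + 1) * 2 * ((k + 1 + j).stirlingSecond (k + 1) * j.factorial * 2 ^ j) := by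
            rw [hrec, Nat.factorial_succ]; ring
        _ ≤ (k + (j + 1)) ^ (2 * (j + 1)) +
            (k + 1 + j) * (j + 1) * 2 * (k + 1 + j) ^ (2 * j) := by
            gcongr ?_ + ?_ * _ * _ * ?_
            exact Nat.le_add_right _ _
        _ = (k + j + 1) ^ (2 * j + 1 + 1) + (2 * j + 1 + 1 : ℕ) * (k + j + 1) ^ (2 * j + 1) := by
            ring
        _ ≤ (k + j + 1 + 1) ^ (2 * j + 1 + 1) := Nat.pow_add_le_add_one_pow _ _
        _ = _ := by ring

/-- For fixed `j`, `S(n, n - j) ∼ (n - j)^{2j} / (j! 2^j)`,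
i.e. `S(n, n-j) · j! · 2^j / (n-j)^{2j} → 1` as `n → ∞`. -/
theorem stirling_asymptotics (j : ℕ) :
    Filter.Tendsto
      (fun n : ℕ =>
        (stirling2 n (n - j) : ℝ) * j.factorial * 2 ^ j / ((n : ℝ) - j) ^ (2 * j))
      Filter.atTop (nhds 1) := by
  rw [← Filter.tendsto_add_atTop_iff_nat j]
  have hupper : Filter.Tendsto (fun k : ℕ => (1 + (j : ℝ) / k) ^ (2 * j))
      Filter.atTop (nhds 1) := by
    simpa using ((tendsto_const_div_atTop_nhds_zero_nat (j : ℝ)).const_add 1).pow (2 * j)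
  refine tendsto_of_tendsto_of_tendsto_of_le_of_le' tendsto_const_nhds hupper ?_ ?_
  all_goals
    filter_upwards [Filter.eventually_gt_atTop 0] with k hk
    have hk' : (0 : ℝ) < k := Nat.cast_pos.2 hk
    rw [Nat.add_sub_cancel, Nat.cast_add, add_sub_cancel_right, stirling2_eq_stirlingSecond]
  · rw [one_le_div (by positivity)]
    exact_mod_cast Nat.pow_le_stirlingSecond_mul j k
  · rw [one_add_div hk'.ne', div_pow]
    gcongr
    exact_mod_cast Nat.stirlingSecond_mul_le_pow j k
end
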